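/- arXiv:1301.6848 — 4 statements merged into one kernel-verified Lean document; each statement's English description precedes it below -/
import Mathlib

section
/- Let a_1 ≤ a_2 ≤ … ≤ a_n be positive reals and let z be a complex number with z ∉ (-∞, -a_1]. Then the principal branch of the geometric mean satisfies the integral representation G_n(a+z) = A_n(a) + z - (1/π) ∑_{ℓ=1}^{n-1} sin(ℓπ/n) ∫_{a_ℓ}^{a_{ℓ+1}} (∏_{k=1}^n |a_k - t|)^{1/n} dt/(t+z). -/
open Filter Topology Asymptotics Bornology

/-- The product of the principal `#s`-th roots of the `a k + w`: the geometric mean of the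
`a k + w`, with the value `0` where one of them vanishes. -/
noncomputable def geomMean {ι : Type*} (s : Finset ι) (a : ι → ℝ) (w : ℂ) : ℂ :=
  ∏ k ∈ s, ((a k : ℂ) + w) ^ ((s.card : ℂ)⁻¹)

/-- The integral over the real line of a function which is holomorphic in the upper half-plane
and decays quadratically vanishes. -/
theorem tendsto_integral_of_isBigO_upperHalfPlane {f : ℂ → ℂ} {t : Set ℂ} (ht : t.Countable)
    (hc : ContinuousOn f {w | 0 ≤ w.im}) (hd : ∀ w, 0 < w.im → w ∉ t → DifferentiableAt ℂ f w)
    (hO : f =O[cobounded ℂ ⊓ 𝓟 {w | 0 ≤ w.im}] fun w => (w ^ 2)⁻¹) :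
    Tendsto (fun R : ℝ => ∫ x in -R..R, f x) atTop (𝓝 0) := by
  obtain ⟨C, hC⟩ := hO.bound
  rw [eventually_inf_principal, ← comap_norm_atTop, eventually_comap, eventually_atTop] at hC
  obtain ⟨r, hr⟩ := hC
  have key : ∀ R : ℝ, max r 1 ≤ R → ‖∫ x in -R..R, f x‖ ≤ (4 * |C|) * R⁻¹ := by
    intro R hR
    have hrR : r ≤ R := (le_max_left _ _).trans hR
    have hR0 : 0 < R := lt_of_lt_of_le one_pos ((le_max_right _ _).trans hR)
    have hb : ∀ w : ℂ, 0 ≤ w.im → R ≤ ‖w‖ → ‖f w‖ ≤ |C| * (R ^ 2)⁻¹ := by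
      intro w hw hRw
      refine (hr ‖w‖ (hrR.trans hRw) w rfl hw).trans ?_
      rw [norm_inv, norm_pow]
      have : (‖w‖ ^ 2)⁻¹ ≤ (R ^ 2)⁻¹ := by gcongr
      calc C * (‖w‖ ^ 2)⁻¹ ≤ |C| * (‖w‖ ^ 2)⁻¹ := by gcongr; exact le_abs_self C
        _ ≤ _ := by gcongr
    have h := Complex.integral_boundary_rect_eq_zero_of_differentiable_on_off_countable f
      ⟨-R, 0⟩ ⟨R, R⟩ t ht (hc.mono ?_) ?_
    · simp only [Complex.ofReal_zero, zero_mul, add_zero] at h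
      have h1 : ‖∫ x in -R..R, f (x + R * Complex.I)‖ ≤ |C| * (R ^ 2)⁻¹ * |R - -R| :=
        intervalIntegral.norm_integral_le_of_norm_le_const fun x _ => by
          refine hb _ (by simpa using hR0.le) ?_
          simpa [abs_of_pos hR0] using Complex.abs_im_le_norm ((x : ℂ) + R * Complex.I)
      have h2 : ‖∫ y in (0 : ℝ)..R, f (R + y * Complex.I)‖ ≤ |C| * (R ^ 2)⁻¹ * |R - 0| :=
        intervalIntegral.norm_integral_le_of_norm_le_const fun x hx => by
          rw [Set.uIoc_of_le hR0.le] at hx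
          refine hb _ (by simpa using hx.1.le) ?_
          simpa [abs_of_pos hR0] using Complex.abs_re_le_norm ((R : ℂ) + x * Complex.I)
      have h3 : ‖∫ y in (0 : ℝ)..R, f ((-R : ℝ) + y * Complex.I)‖ ≤ |C| * (R ^ 2)⁻¹ * |R - 0| :=
        intervalIntegral.norm_integral_le_of_norm_le_const fun x hx => by
          rw [Set.uIoc_of_le hR0.le] at hx
          refine hb _ (by simpa using hx.1.le) ?_
          simpa [abs_of_pos hR0] using Complex.abs_re_le_norm (((-R : ℝ) : ℂ) + x * Complex.I)
      have e : (∫ x in -R..R, f x) = (∫ x in -R..R, f (x + R * Complex.I))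
          - Complex.I • (∫ y in (0 : ℝ)..R, f (R + y * Complex.I))
          + Complex.I • (∫ y in (0 : ℝ)..R, f ((-R : ℝ) + y * Complex.I)) := by
        linear_combination h
      rw [e]
      refine (norm_add_le _ _).trans ((add_le_add_left (norm_sub_le _ _) _).trans ?_)
      rw [norm_smul, norm_smul, Complex.norm_I, one_mul, one_mul]
      refine (add_le_add (add_le_add h1 h2) h3).trans (le_of_eq ?_)
      rw [abs_of_pos (by linarith : 0 < R - -R), abs_of_pos (by linarith : 0 < R - 0)]
      field_simp
      ring
    · rintro w ⟨-, hw⟩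
      simp only [Set.mem_preimage, Set.uIcc_of_le hR0.le] at hw
      exact hw.1
    · rintro w ⟨⟨-, hw⟩, hwt⟩
      simp only [Set.mem_preimage, min_eq_left hR0.le] at hw
      exact hd w hw.1 hwt
  refine squeeze_zero_norm' ((eventually_ge_atTop (max r 1)).mono key) ?_
  simpa using tendsto_inv_atTop_zero.const_mul (4 * |C|)

theorem continuousOn_cpow_const_upperHalfPlane {p : ℂ} (hp : 0 < p.re) :
    ContinuousOn (fun w : ℂ => w ^ p) {w | 0 ≤ w.im} := by
  intro w hw
  by_cases h : 0 ≤ w.re ∨ w.im ≠ 0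
  · exact (Complex.continuousAt_cpow_const_of_re_pos h hp).continuousWithinAt
  · push Not at h
    have hw0 : w ≠ 0 := by rintro rfl; simp at h
    have hlog := Complex.continuousWithinAt_log_of_re_neg_of_im_zero h.1 h.2
    refine ((hlog.mul_const p).cexp).congr_of_eventuallyEq ?_ (Complex.cpow_def_of_ne_zero hw0 p)
    filter_upwards [nhdsWithin_le_nhds (isOpen_ne.mem_nhds hw0)] with v hv
    exact Complex.cpow_def_of_ne_zero hv p

section geomMean

variable {ι : Type*} {s : Finset ι} {a : ι → ℝ}

theorem geomMean_eq_exp {w : ℂ} (hw : ∀ k ∈ s, (a k : ℂ) + w ≠ 0) :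
    geomMean s a w
      = Complex.exp ((s.card : ℂ)⁻¹ * ∑ k ∈ s, Complex.log ((a k : ℂ) + w)) := by
  rw [geomMean, Finset.mul_sum, Complex.exp_sum]
  refine Finset.prod_congr rfl fun k hk => ?_
  rw [Complex.cpow_def_of_ne_zero (hw k hk), mul_comm]

theorem continuousOn_geomMean_upperHalfPlane (hs : s.Nonempty) :
    ContinuousOn (geomMean s a) {w | 0 ≤ w.im} := by
  refine continuousOn_finsetProd _ fun k _ => ?_
  have hp : 0 < ((s.card : ℂ)⁻¹).re := by
    rw [← Complex.ofReal_natCast, ← Complex.ofReal_inv, Complex.ofReal_re]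
    have := hs.card_pos
    positivity
  exact (continuousOn_cpow_const_upperHalfPlane hp).comp
    (continuous_const.add continuous_id).continuousOn fun w hw => by simpa using hw

theorem differentiableAt_geomMean {w : ℂ} (hw : ∀ k ∈ s, (a k : ℂ) + w ∈ Complex.slitPlane) :
    DifferentiableAt ℂ (geomMean s a) w := by
  refine DifferentiableAt.fun_finsetProd fun k hk => ?_
  exact ((differentiableAt_const _).add differentiableAt_id).cpow_const (hw k hk)

theorem geomMean_conj {w : ℂ} (hw : ∀ k ∈ s, (a k : ℂ) + w ∈ Complex.slitPlane) :
    geomMean s a (starRingEnd ℂ w) = starRingEnd ℂ (geomMean s a w) := by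
  rw [geomMean, geomMean, map_prod]
  refine Finset.prod_congr rfl fun k hk => ?_
  have h := Complex.conj_cpow ((a k : ℂ) + w) ((s.card : ℂ)⁻¹)
    (Complex.slitPlane_arg_ne_pi (hw k hk))
  simpa using h

theorem log_ofReal_add_eq {b : ℝ} (hb : 0 ≤ b) {w : ℂ} (hw : 0 ≤ w.im) (hbw : b < ‖w‖) :
    Complex.log ((b : ℂ) + w) = Complex.log w + Complex.log (1 + b * w⁻¹) := by
  have hw0 : w ≠ 0 := norm_pos_iff.1 (hb.trans_lt hbw)
  have hlt : ‖(b : ℂ) * w⁻¹‖ < 1 := by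
    rw [norm_mul, norm_inv, Complex.norm_real, Real.norm_of_nonneg hb,
      mul_inv_lt_iff₀ (hb.trans_lt hbw), one_mul]
    exact hbw
  have hre : 0 < (1 + (b : ℂ) * w⁻¹).re := by
    have := (abs_le.1 (Complex.abs_re_le_norm ((b : ℂ) * w⁻¹))).1
    rw [Complex.add_re, Complex.one_re]
    linarith
  have him : (1 + (b : ℂ) * w⁻¹).im ≤ 0 := by
    rw [Complex.add_im, Complex.one_im, zero_add]
    rw [Complex.im_ofReal_mul, Complex.inv_im]
    exact mul_nonpos_of_nonneg_of_nonpos hb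
      (div_nonpos_of_nonpos_of_nonneg (by linarith) (Complex.normSq_nonneg _))
  have h0 : 1 + (b : ℂ) * w⁻¹ ≠ 0 := fun h => by rw [h] at hre; simp at hre
  have e : (b : ℂ) + w = w * (1 + b * w⁻¹) := by field_simp; ring
  rw [e, Complex.log_mul_eq_add_log_iff hw0 h0]
  have h1 : |(1 + (b : ℂ) * w⁻¹).arg| < Real.pi / 2 :=
    Complex.abs_arg_lt_pi_div_two_iff.2 (Or.inl hre)
  have h2 : (1 + (b : ℂ) * w⁻¹).arg ≤ 0 := by
    by_contra! h
    have h3 := Complex.arg_nonneg_iff.1 h.le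
    have h4 := Complex.arg_eq_zero_iff.2 ⟨hre.le, le_antisymm him h3⟩
    exact h.ne' h4
  have h3 := Complex.arg_nonneg_iff.2 hw
  have h4 := Complex.arg_le_pi w
  have h5 := Real.pi_pos
  rw [abs_lt] at h1
  exact ⟨by linarith [h1.1], by linarith⟩

theorem isBigO_geomMean_sub (hs : s.Nonempty) (ha : ∀ k ∈ s, 0 < a k) :
    (fun w => geomMean s a w - w - (((∑ k ∈ s, a k) / s.card : ℝ) : ℂ))
      =O[cobounded ℂ ⊓ 𝓟 {w | 0 ≤ w.im}] fun w => w⁻¹ := by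
  have hn : (s.card : ℂ) ≠ 0 := by exact_mod_cast hs.card_pos.ne'
  set A : ℂ := (((∑ k ∈ s, a k) / s.card : ℝ) : ℂ) with hA
  let F : ℂ → ℂ := fun u => Complex.exp ((s.card : ℂ)⁻¹ * ∑ k ∈ s, Complex.log (1 + a k * u))
  have hslit : ∀ᶠ u : ℂ in 𝓝 0, ∀ k ∈ s, 1 + (a k : ℂ) * u ∈ Complex.slitPlane := by
    refine (Finset.eventually_all s).2 fun k _ => ?_
    have hcont : ContinuousAt (fun u : ℂ => 1 + (a k : ℂ) * u) 0 := by fun_prop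
    exact hcont.eventually_mem (Complex.isOpen_slitPlane.mem_nhds (by simp))
  have hFd : ∀ᶠ u in 𝓝 0, DifferentiableAt ℂ F u := by
    filter_upwards [hslit] with u hu
    refine ((DifferentiableAt.fun_sum fun k hk => ?_).const_mul _).cexp
    exact DifferentiableAt.clog (by fun_prop) (hu k hk)
  have hF0 : F 0 = 1 := by simp [F]
  have hFderiv : deriv F 0 = A := by
    refine HasDerivAt.deriv ?_
    have hsum : HasDerivAt (fun u : ℂ => ∑ k ∈ s, Complex.log (1 + a k * u)) (∑ k ∈ s, (a k : ℂ)) 0 := by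
      refine HasDerivAt.fun_sum fun k _ => ?_
      have := (((hasDerivAt_id (0 : ℂ)).const_mul (a k : ℂ)).const_add 1).clog (by simp)
      simpa using this
    have := (hsum.const_mul ((s.card : ℂ)⁻¹)).cexp
    have hval : Complex.exp ((s.card : ℂ)⁻¹ * ∑ k ∈ s, Complex.log (1 + a k * 0))
        * ((s.card : ℂ)⁻¹ * ∑ k ∈ s, (a k : ℂ)) = A := by
      simp [hA, div_eq_inv_mul]
    rwa [hval] at this
  have hO : (fun u => F u - 1 - A * u) =O[𝓝 0] fun u => u * u := by
    obtain ⟨t, ht, htd⟩ := hFd.exists_mem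
    have hdd : DifferentiableAt ℂ (dslope F 0) 0 :=
      ((Complex.differentiableOn_dslope ht).2 fun u hu =>
        (htd u hu).differentiableWithinAt).differentiableAt ht
    have := (isBigO_refl (fun u : ℂ => u) (𝓝 0)).mul hdd.isBigO_sub
    refine this.congr (fun u => ?_) fun u => by simp
    have h1 := sub_smul_dslope F 0 u
    rw [dslope_same, hFderiv, mul_sub]
    rw [sub_zero, smul_eq_mul, hF0] at h1
    rw [h1]
    ring
  have hO' := hO.comp_tendsto (tendsto_inv₀_cobounded (α := ℂ))
  have hO'' := (isBigO_refl (fun w : ℂ => w) (cobounded ℂ)).mul hO'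
  refine (hO''.mono inf_le_left).congr' ?_ ?_
  · have hlarge : ∀ᶠ w in cobounded ℂ, w ≠ 0 ∧ ∀ k ∈ s, a k < ‖w‖ := by
      refine (eventually_ne_cobounded 0).and ((Finset.eventually_all s).2 fun k _ => ?_)
      exact tendsto_norm_cobounded_atTop.eventually_gt_atTop (a k)
    filter_upwards [hlarge.filter_mono inf_le_left,
      mem_inf_of_right (mem_principal_self _)] with w hw him
    obtain ⟨hw0, hw⟩ := hw
    have hne : ∀ k ∈ s, (a k : ℂ) + w ≠ 0 := by
      intro k hk h
      have := hw k hk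
      rw [eq_neg_of_add_eq_zero_right h, norm_neg, Complex.norm_real,
        Real.norm_of_nonneg (ha k hk).le] at this
      exact lt_irrefl _ this
    have : geomMean s a w = w * F w⁻¹ := by
      rw [geomMean_eq_exp hne,
        Finset.sum_congr rfl fun k hk => log_ofReal_add_eq (ha k hk).le him (hw k hk),
        Finset.sum_add_distrib, Finset.sum_const, nsmul_eq_mul, mul_add,
        inv_mul_cancel_left₀ hn, Complex.exp_add, Complex.exp_log hw0]
    simp only [Function.comp, this]
    field_simp
  · filter_upwards [(eventually_ne_cobounded (0 : ℂ)).filter_mono inf_le_left] with w hw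
    simp only [Function.comp]
    field_simp

theorem isBigO_inv_sub_const_cobounded (z : ℂ) :
    (fun w : ℂ => (w - z)⁻¹) =O[cobounded ℂ] fun w => w⁻¹ := by
  refine (isLittleO_const_id_cobounded z).right_isBigO_sub.inv_rev ?_
  filter_upwards [eventually_ne_cobounded (0 : ℂ)] with w hw h
  exact absurd h hw

theorem isBigO_dslope_geomMean (hs : s.Nonempty) (ha : ∀ k ∈ s, 0 < a k) (z : ℂ) :
    (fun w => dslope (geomMean s a) z w - 1 -
        (z + (((∑ k ∈ s, a k) / s.card : ℝ) : ℂ) - geomMean s a z) * (w + Complex.I)⁻¹)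
      =O[cobounded ℂ ⊓ 𝓟 {w | 0 ≤ w.im}] fun w => (w ^ 2)⁻¹ := by
  set A : ℂ := (((∑ k ∈ s, a k) / s.card : ℝ) : ℂ) with hA
  have h1 := (isBigO_geomMean_sub hs ha).mul ((isBigO_inv_sub_const_cobounded z).mono inf_le_left)
  have h2 := (((isBigO_inv_sub_const_cobounded z).mul
    (isBigO_inv_sub_const_cobounded (-Complex.I))).const_mul_left
      ((z + A - geomMean s a z) * (z + Complex.I))).mono
        (inf_le_left : cobounded ℂ ⊓ 𝓟 {w | 0 ≤ w.im} ≤ _)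
  refine (h1.add h2).congr' ?_ (.of_eq (funext fun w => by rw [sq, mul_inv]))
  filter_upwards [(eventually_ne_cobounded z).filter_mono inf_le_left,
    (eventually_ne_cobounded (-Complex.I)).filter_mono inf_le_left] with w hz hI
  rw [dslope_of_ne _ hz, slope_def_field, sub_neg_eq_add]
  have h3 : w - z ≠ 0 := sub_ne_zero.2 hz
  have h4 : w + Complex.I ≠ 0 := fun h => hI (eq_neg_of_add_eq_zero_left h)
  field_simp
  ring

theorem continuousOn_dslope_geomMean_upperHalfPlane (hs : s.Nonempty) {z : ℂ}
    (hz : ∀ k ∈ s, (a k : ℂ) + z ∈ Complex.slitPlane) :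
    ContinuousOn (dslope (geomMean s a) z) {w | 0 ≤ w.im} := by
  intro w hw
  rcases eq_or_ne w z with rfl | h
  · exact (continuousAt_dslope_same.2 (differentiableAt_geomMean hz)).continuousWithinAt
  · exact (continuousWithinAt_dslope_of_ne h).2 (continuousOn_geomMean_upperHalfPlane hs w hw)

theorem continuousOn_dslope_geomMean_sub (hs : s.Nonempty) {z : ℂ}
    (hz : ∀ k ∈ s, (a k : ℂ) + z ∈ Complex.slitPlane) (c : ℂ) :
    ContinuousOn (fun w => dslope (geomMean s a) z w - 1 - c * (w + Complex.I)⁻¹)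
      {w | 0 ≤ w.im} := by
  refine ((continuousOn_dslope_geomMean_upperHalfPlane hs hz).sub continuousOn_const).sub
    (continuousOn_const.mul (ContinuousOn.inv₀ (by fun_prop) fun w hw h => ?_))
  have := congrArg Complex.im h
  simp only [Set.mem_ofPred_eq, Complex.add_im, Complex.I_im, Complex.zero_im] at this hw
  linarith

theorem tendsto_integral_dslope_geomMean (hs : s.Nonempty) (ha : ∀ k ∈ s, 0 < a k) {z : ℂ}
    (hz : ∀ k ∈ s, (a k : ℂ) + z ∈ Complex.slitPlane) :
    Tendsto (fun R : ℝ => ∫ x in -R..R, (dslope (geomMean s a) z x - 1 -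
        (z + (((∑ k ∈ s, a k) / s.card : ℝ) : ℂ) - geomMean s a z) * (x + Complex.I)⁻¹))
      atTop (𝓝 0) := by
  refine tendsto_integral_of_isBigO_upperHalfPlane (f := fun w => dslope (geomMean s a) z w - 1 -
        (z + (((∑ k ∈ s, a k) / s.card : ℝ) : ℂ) - geomMean s a z) * (w + Complex.I)⁻¹)
    (Set.countable_singleton z)
    (continuousOn_dslope_geomMean_sub hs hz _) (fun w hw hwz => ?_) (isBigO_dslope_geomMean hs ha z)
  have h1 : w + Complex.I ≠ 0 := fun h => by
    have := congrArg Complex.im h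
    simp only [Complex.add_im, Complex.I_im, Complex.zero_im] at this
    linarith
  have h2 : DifferentiableAt ℂ (dslope (geomMean s a) z) w :=
    (differentiableAt_dslope_of_ne hwz).2 <| differentiableAt_geomMean fun k _ =>
      Complex.mem_slitPlane_iff.2 (Or.inr (by simpa using hw.ne'))
  exact (h2.sub_const 1).sub
    ((((differentiableAt_id (𝕜 := ℂ) (x := w)).add_const Complex.I).inv h1).const_mul _)

/-- The value of `z + A - G(z)` as a Cauchy integral of the boundary values of `Im G`. -/
theorem tendsto_integral_im_geomMean_div (hs : s.Nonempty) (ha : ∀ k ∈ s, 0 < a k) {z : ℂ}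
    (hz : ∀ k ∈ s, (a k : ℂ) + z ∈ Complex.slitPlane) :
    Tendsto (fun R : ℝ => ∫ x in -R..R, ((geomMean s a x).im : ℂ) / (x - z)) atTop
      (𝓝 (-(Real.pi * (z + (((∑ k ∈ s, a k) / s.card : ℝ) : ℂ) - geomMean s a z)))) := by
  have hz' : ∀ k ∈ s, (a k : ℂ) + starRingEnd ℂ z ∈ Complex.slitPlane := fun k hk => by
    have h := hz k hk
    rw [Complex.mem_slitPlane_iff] at h ⊢
    simpa using h
  have T1 := tendsto_integral_dslope_geomMean hs ha hz
  have T2 := tendsto_integral_dslope_geomMean hs ha hz'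
  have C1 := continuousOn_dslope_geomMean_sub hs hz
    (z + (((∑ k ∈ s, a k) / s.card : ℝ) : ℂ) - geomMean s a z)
  have C2 := continuousOn_dslope_geomMean_sub hs hz'
    (starRingEnd ℂ z + (((∑ k ∈ s, a k) / s.card : ℝ) : ℂ) - geomMean s a (starRingEnd ℂ z))
  set A : ℝ := (∑ k ∈ s, a k) / s.card
  set c : ℂ := z + (A : ℂ) - geomMean s a z with hc
  have hc' : starRingEnd ℂ z + (A : ℂ) - geomMean s a (starRingEnd ℂ z) = starRingEnd ℂ c := by
    rw [geomMean_conj hz, hc]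
    simp
  rw [hc'] at T2 C2
  have hreal : Set.MapsTo (fun x : ℝ => (x : ℂ)) Set.univ {w : ℂ | 0 ≤ w.im} := fun x _ => by simp
  have D1 := continuousOn_univ.1 (C1.comp Complex.continuous_ofReal.continuousOn hreal)
  have D2 := continuousOn_univ.1 (C2.comp Complex.continuous_ofReal.continuousOn hreal)
  simp only [Function.comp_def] at D1 D2
  have D3 : Continuous fun x : ℝ => c * (((1 + x ^ 2)⁻¹ : ℝ) : ℂ) :=
    continuous_const.mul (Complex.continuous_ofReal.comp
      (Continuous.inv₀ (by fun_prop) fun x => by positivity))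
  have T2' := (Complex.continuous_conj.tendsto 0).comp T2
  have T3 : Tendsto (fun R : ℝ => ∫ x in -R..R, c * (((1 + x ^ 2)⁻¹ : ℝ) : ℂ)) atTop
      (𝓝 (c * Real.pi)) := by
    have : Tendsto (fun R : ℝ => 2 * Real.arctan R) atTop (𝓝 (2 * (Real.pi / 2))) :=
      (Real.tendsto_arctan_atTop.mono_right nhdsWithin_le_nhds).const_mul 2
    rw [mul_div_cancel₀ _ (two_ne_zero' ℝ)] at this
    refine (((Complex.continuous_ofReal.tendsto _).comp this).const_mul c).congr fun R => ?_
    rw [intervalIntegral.integral_const_mul, intervalIntegral.integral_ofReal,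
      integral_inv_one_add_sq, Real.arctan_neg, Function.comp_apply]
    congr 2
    ring
  have T := ((T1.sub T2').const_mul ((2 * Complex.I)⁻¹)).sub T3
  simp only [map_zero, sub_zero, mul_zero, zero_sub] at T
  rw [mul_comm (Real.pi : ℂ)]
  refine T.congr fun R => ?_
  rw [Function.comp_apply]
  have hconj : starRingEnd ℂ (∫ x in -R..R, (dslope (geomMean s a) (starRingEnd ℂ z) x - 1 -
        starRingEnd ℂ c * ((x : ℂ) + Complex.I)⁻¹)) =
      ∫ x in -R..R, starRingEnd ℂ (dslope (geomMean s a) (starRingEnd ℂ z) x - 1 -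
        starRingEnd ℂ c * ((x : ℂ) + Complex.I)⁻¹) :=
    (Complex.conjCLE.toContinuousLinearMap.intervalIntegral_comp_comm
      (D2.intervalIntegrable (μ := MeasureTheory.volume) (-R) R)).symm
  have I1 := D1.intervalIntegrable (μ := MeasureTheory.volume) (-R) R
  have I2 := (Complex.continuous_conj.comp D2).intervalIntegrable (μ := MeasureTheory.volume) (-R) R
  have I3 := D3.intervalIntegrable (μ := MeasureTheory.volume) (-R) R
  simp only [Function.comp_def] at I2
  rw [hconj, ← intervalIntegral.integral_sub I1 I2, ← intervalIntegral.integral_const_mul,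
    ← intervalIntegral.integral_sub ((I1.sub I2).const_mul _) I3]
  refine intervalIntegral.integral_congr_ae ?_
  have hae : ∀ᵐ x : ℝ, x ≠ z.re := by
    simp [MeasureTheory.ae_iff]
  filter_upwards [hae] with x hx _
  have hxz : (x : ℂ) ≠ z := fun h => hx (by rw [← h, Complex.ofReal_re])
  have hxz' : (x : ℂ) ≠ starRingEnd ℂ z := fun h => hx (by
    rw [← Complex.conj_re, ← h, Complex.ofReal_re])
  rw [dslope_of_ne _ hxz, dslope_of_ne _ hxz', slope_def_field, slope_def_field, geomMean_conj hz]
  simp only [map_sub, map_mul, map_div₀, map_inv₀, map_add, Complex.conj_conj, Complex.conj_ofReal,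
    Complex.conj_I, map_one]
  have h1 := sub_ne_zero.2 hxz
  have h2 : (x : ℂ) + Complex.I ≠ 0 := fun h => by simpa using congrArg Complex.im h
  have h3 : (x : ℂ) + -Complex.I ≠ 0 := fun h => by simpa using congrArg Complex.im h
  have h4 : ((x : ℂ) + Complex.I)⁻¹ - ((x : ℂ) + -Complex.I)⁻¹
      = -(2 * Complex.I) * (((1 + x ^ 2)⁻¹ : ℝ) : ℂ) := by
    have h5 : (((1 + x ^ 2)⁻¹ : ℝ) : ℂ) = ((x : ℂ) + Complex.I)⁻¹ * ((x : ℂ) + -Complex.I)⁻¹ := by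
      rw [← mul_inv, Complex.ofReal_inv]
      congr 1
      push_cast
      linear_combination Complex.I_sq
    rw [h5]
    field_simp
    ring
  have h6 : geomMean s a x - starRingEnd ℂ (geomMean s a x)
      = 2 * Complex.I * ((geomMean s a x).im : ℂ) := by
    rw [Complex.sub_conj]
    push_cast
    ring
  have hI : (2 * Complex.I) ≠ 0 := by simp
  rw [inv_mul_eq_div, sub_eq_iff_eq_add, div_eq_iff hI]
  linear_combination ((x : ℂ) - z)⁻¹ * h6 - c * h4

/-- Boundary values of the imaginary part of the geometric mean on the cut. -/
theorem geomMean_neg_im {r u : Finset ι} [DecidableEq ι] (hd : Disjoint r u) {t : ℝ}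
    (hr : ∀ k ∈ r, a k ≤ t) (hu : ∀ k ∈ u, t ≤ a k) :
    (geomMean (r ∪ u) a ((-t : ℝ) : ℂ)).im
      = (∏ k ∈ r ∪ u, |a k - t|) ^ (((r ∪ u).card : ℝ)⁻¹)
        * Real.sin (r.card * Real.pi / (r ∪ u).card) := by
  set n := (r ∪ u).card
  have hp : ((n : ℂ)⁻¹) = (((n : ℝ)⁻¹ : ℝ) : ℂ) := by push_cast; rfl
  have hneg : ∀ k ∈ r, ((a k : ℂ) + ((-t : ℝ) : ℂ)) ^ ((n : ℂ)⁻¹)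
      = ((|a k - t| ^ ((n : ℝ)⁻¹) : ℝ) : ℂ) * Complex.exp (Real.pi * Complex.I * (n : ℂ)⁻¹) := by
    intro k hk
    have h : a k - t ≤ 0 := sub_nonpos.2 (hr k hk)
    rw [← Complex.ofReal_add, ← sub_eq_add_neg, Complex.ofReal_cpow_of_nonpos h, abs_of_nonpos h,
      hp, Complex.ofReal_cpow (neg_nonneg.2 h), Complex.ofReal_neg]
  have hpos : ∀ k ∈ u, ((a k : ℂ) + ((-t : ℝ) : ℂ)) ^ ((n : ℂ)⁻¹)
      = ((|a k - t| ^ ((n : ℝ)⁻¹) : ℝ) : ℂ) := by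
    intro k hk
    have h : 0 ≤ a k - t := sub_nonneg.2 (hu k hk)
    rw [← Complex.ofReal_add, ← sub_eq_add_neg, abs_of_nonneg h, hp, Complex.ofReal_cpow h]
  have key : geomMean (r ∪ u) a ((-t : ℝ) : ℂ)
      = (((∏ k ∈ r ∪ u, |a k - t|) ^ ((n : ℝ)⁻¹) : ℝ) : ℂ)
        * Complex.exp (((r.card * Real.pi / n : ℝ) : ℂ) * Complex.I) := by
    rw [geomMean, Finset.prod_union hd, Finset.prod_congr rfl hneg, Finset.prod_congr rfl hpos,
      Finset.prod_mul_distrib, Finset.prod_const, ← Complex.exp_nat_mul,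
      ← Real.finsetProd_rpow _ _ fun k _ => abs_nonneg _, Finset.prod_union hd]
    push_cast
    rw [mul_right_comm]
    congr 2
    ring
  rw [key, Complex.im_ofReal_mul, Complex.exp_ofReal_mul_I_im]

end geomMean

theorem geomMean_Icc_neg_im {n : ℕ} {a : ℕ → ℝ} {ℓ : ℕ} (hℓ : ℓ ≤ n) {t : ℝ}
    (hl : ∀ k ∈ Finset.Icc 1 ℓ, a k ≤ t) (hu : ∀ k ∈ Finset.Icc (ℓ + 1) n, t ≤ a k) :
    (geomMean (Finset.Icc 1 n) a ((-t : ℝ) : ℂ)).im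
      = (∏ k ∈ Finset.Icc 1 n, |a k - t|) ^ ((n : ℝ)⁻¹) * Real.sin (ℓ * Real.pi / n) := by
  have hunion : Finset.Icc 1 ℓ ∪ Finset.Icc (ℓ + 1) n = Finset.Icc 1 n := by
    ext k
    simp only [Finset.mem_union, Finset.mem_Icc]
    omega
  have hd : Disjoint (Finset.Icc 1 ℓ) (Finset.Icc (ℓ + 1) n) := by
    refine Finset.disjoint_left.2 fun k h1 h2 => ?_
    simp only [Finset.mem_Icc] at h1 h2
    omega
  have h := geomMean_neg_im hd hl hu
  rw [hunion] at h
  simpa using h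


/-- Integral representation of the principal branch of the geometric mean:
for `0 < a 1 ≤ … ≤ a n` and `z ∈ ℂ \ (-∞, -a 1]`,
`G_n(a+z) = A_n(a) + z - (1/π) ∑_{ℓ=1}^{n-1} sin(ℓπ/n) ∫_{a_ℓ}^{a_{ℓ+1}} (∏ |a_k-t|)^{1/n} dt/(t+z)`. -/
theorem geometric_mean_integral_representation (n : ℕ) (hn : 0 < n) (a : ℕ → ℝ)
    (hpos : ∀ k ∈ Finset.Icc 1 n, 0 < a k)
    (hmono : ∀ k ∈ Finset.Icc 1 (n - 1), a k ≤ a (k + 1))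
    (z : ℂ) (hz : z ∉ {w : ℂ | w.im = 0 ∧ w.re ≤ -a 1}) :
    Complex.exp ((n : ℂ)⁻¹ * ∑ k ∈ Finset.Icc 1 n, Complex.log ((a k : ℂ) + z))
      = (((∑ k ∈ Finset.Icc 1 n, a k) / n : ℝ) : ℂ) + z -
        ((1 / Real.pi : ℝ) : ℂ) * ∑ ℓ ∈ Finset.Icc 1 (n - 1),
          ((Real.sin (ℓ * Real.pi / n) : ℝ) : ℂ) *
            ∫ t in (a ℓ)..(a (ℓ + 1)),
              (((∏ k ∈ Finset.Icc 1 n, |a k - t|) ^ ((n : ℝ)⁻¹) : ℝ) : ℂ) /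
                ((t : ℂ) + z) := by
  have hle : ∀ j k : ℕ, 1 ≤ j → j ≤ k → k ≤ n → a j ≤ a k := by
    intro j k hj hjk
    induction k, hjk using Nat.le_induction with
    | base => exact fun _ => le_rfl
    | succ k hjk ih =>
      exact fun hk => (ih (by omega)).trans (hmono k (Finset.mem_Icc.2 (by omega)))
  have hslit1 : ∀ t : ℝ, a 1 ≤ t → (t : ℂ) + z ∈ Complex.slitPlane := by
    intro t ht
    rw [Complex.mem_slitPlane_iff, Complex.add_re, Complex.add_im, Complex.ofReal_re,
      Complex.ofReal_im, zero_add]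
    by_contra! h
    exact hz ⟨h.2, by linarith⟩
  have hslit : ∀ k ∈ Finset.Icc 1 n, (a k : ℂ) + z ∈ Complex.slitPlane := fun k hk =>
    hslit1 _ (hle 1 k le_rfl (Finset.mem_Icc.1 hk).1 (Finset.mem_Icc.1 hk).2)
  have hs : (Finset.Icc 1 n).Nonempty := ⟨1, Finset.mem_Icc.2 ⟨le_rfl, hn⟩⟩
  have hn0 : (n : ℝ) ≠ 0 := by exact_mod_cast hn.ne'
  have hG := geomMean_eq_exp fun k hk => Complex.slitPlane_ne_zero (hslit k hk)
  rw [Nat.card_Icc, Nat.add_sub_cancel] at hG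
  rw [← hG]
  have hT := tendsto_integral_im_geomMean_div hs hpos hslit
  rw [Nat.card_Icc, Nat.add_sub_cancel] at hT
  set g := geomMean (Finset.Icc 1 n) a with hg
  let f : ℝ → ℂ := fun t => ((g ((-t : ℝ) : ℂ)).im : ℂ) / ((t : ℂ) + z)
  have hgc : Continuous fun t : ℝ => ((g ((-t : ℝ) : ℂ)).im : ℂ) := by
    have h1 : Continuous fun t : ℝ => g ((-t : ℝ) : ℂ) :=
      continuousOn_univ.1 ((continuousOn_geomMean_upperHalfPlane hs).comp
        (Complex.continuous_ofReal.comp continuous_neg).continuousOn fun t _ => by simp)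
    exact Complex.continuous_ofReal.comp (Complex.continuous_im.comp h1)
  have hfint : ∀ b c : ℝ, a 1 ≤ b → b ≤ c → IntervalIntegrable f MeasureTheory.volume b c := by
    intro b c hb hbc
    refine ContinuousOn.intervalIntegrable (hgc.continuousOn.div (by fun_prop) fun t ht => ?_)
    rw [Set.uIcc_of_le hbc] at ht
    exact Complex.slitPlane_ne_zero (hslit1 t (hb.trans ht.1))
  have hlow : ∀ t : ℝ, t ≤ a 1 → f t = 0 := by
    intro t ht
    have h := geomMean_Icc_neg_im (n := n) (a := a) (t := t) (Nat.zero_le n)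
      (fun k hk => by simp at hk)
      fun k hk => ht.trans (hle 1 k le_rfl (Finset.mem_Icc.1 hk).1 (Finset.mem_Icc.1 hk).2)
    simp only [f, hg, h]
    simp
  have hhigh : ∀ t : ℝ, a n ≤ t → f t = 0 := by
    intro t ht
    have h := geomMean_Icc_neg_im (n := n) (a := a) (t := t) le_rfl
      (fun k hk => (hle k n (Finset.mem_Icc.1 hk).1 (Finset.mem_Icc.1 hk).2 le_rfl).trans ht)
      fun k hk => by simp at hk
    simp only [f, hg, h, mul_div_cancel_left₀ _ hn0]
    simp
  have hconst : ∀ R : ℝ, a n ≤ R →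
      ∫ x in -R..R, ((g x).im : ℂ) / (x - z) = -∫ t in a 1..a n, f t := by
    intro R hR
    have h1 := hpos 1 (Finset.mem_Icc.2 ⟨le_rfl, hn⟩)
    have h1n := hle 1 n le_rfl hn le_rfl
    have hz1 : Set.EqOn f (fun _ => 0) (Set.uIcc (-R) (a 1)) := fun t ht => by
      rw [Set.uIcc_of_le (by linarith)] at ht
      exact hlow t ht.2
    have hz2 : Set.EqOn f (fun _ => 0) (Set.uIcc (a n) R) := fun t ht => by
      rw [Set.uIcc_of_le hR] at ht
      exact hhigh t ht.1
    have i1 : IntervalIntegrable f MeasureTheory.volume (-R) (a 1) :=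
      (continuousOn_const.congr hz1).intervalIntegrable
    have i2 := hfint (a 1) (a n) le_rfl h1n
    have i3 := hfint (a n) R h1n hR
    have hsub := intervalIntegral.integral_comp_neg (a := -R) (b := R)
      fun x : ℝ => ((g x).im : ℂ) / (x - z)
    rw [neg_neg] at hsub
    have hsplit : ∫ t in -R..R, f t = ∫ t in a 1..a n, f t := by
      rw [← intervalIntegral.integral_add_adjacent_intervals (i1.trans i2) i3,
        ← intervalIntegral.integral_add_adjacent_intervals i1 i2,
        intervalIntegral.integral_congr hz1, intervalIntegral.integral_congr hz2]
      simp
    rw [← hsub, ← hsplit, ← intervalIntegral.integral_neg]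
    refine intervalIntegral.integral_congr fun t _ => ?_
    simp only [f]
    rw [← div_neg, neg_add', Complex.ofReal_neg]
  have hlim := tendsto_nhds_unique hT
    (tendsto_const_nhds.congr' ((eventually_ge_atTop (a n)).mono fun R hR => (hconst R hR).symm))
  have hsum : ∑ ℓ ∈ Finset.Icc 1 (n - 1), ((Real.sin (ℓ * Real.pi / n) : ℝ) : ℂ) *
      ∫ t in (a ℓ)..(a (ℓ + 1)), (((∏ k ∈ Finset.Icc 1 n, |a k - t|) ^ ((n : ℝ)⁻¹) : ℝ) : ℂ) /
        ((t : ℂ) + z) = ∫ t in a 1..a n, f t := by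
    have hIco : Finset.Icc 1 (n - 1) = Finset.Ico 1 n := by
      ext k
      simp only [Finset.mem_Icc, Finset.mem_Ico]
      omega
    rw [← intervalIntegral.sum_integral_adjacent_intervals_Ico hn fun k hk =>
      hfint _ _ (hle 1 k le_rfl hk.1 hk.2.le) (hle k (k + 1) hk.1 k.le_succ hk.2), hIco]
    refine Finset.sum_congr rfl fun ℓ hℓ => ?_
    rw [Finset.mem_Ico] at hℓ
    rw [← intervalIntegral.integral_const_mul]
    refine intervalIntegral.integral_congr fun t ht => ?_
    rw [Set.uIcc_of_le (hle ℓ (ℓ + 1) hℓ.1 ℓ.le_succ hℓ.2)] at ht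
    have h := geomMean_Icc_neg_im (n := n) (a := a) (t := t) hℓ.2.le
      (fun k hk => (hle k ℓ (Finset.mem_Icc.1 hk).1 (Finset.mem_Icc.1 hk).2 hℓ.2.le).trans ht.1)
      fun k hk => ht.2.trans
        (hle (ℓ + 1) k (by omega) (Finset.mem_Icc.1 hk).1 (Finset.mem_Icc.1 hk).2)
    simp only [f, hg, h]
    push_cast
    ring
  rw [hsum, ← neg_inj.1 hlim]
  have hpi : (Real.pi : ℂ) ≠ 0 := by exact_mod_cast Real.pi_ne_zero
  rw [one_div, Complex.ofReal_inv, inv_mul_cancel_left₀ hpi]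
  ring
end

section
/- Let a_1 ≤ a_2 ≤ … ≤ a_n be positive reals, not all equal. For real t > -a_1, the geometric mean G_n(a+t) = (∏_{k=1}^n (a_k+t))^{1/n} has derivative G_n'(a+t) = 1 + (1/π) ∑_{ℓ=1}^{n-1} sin(ℓπ/n) ∫_{a_ℓ}^{a_{ℓ+1}} (∏_{k=1}^n |a_k - s|)^{1/n} ds/(s+t)^2, and consequently G_n(a+t) is a Bernstein function of t on (-a_1, ∞). -/
section

open Filter Topology Complex MeasureTheory Set

/-- Let `F` be holomorphic in the upper half plane, continuous up to the real line, holomorphic near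
the real point `t`, with `F t` and `F' t` real and `F z = z + O(1)`. Then `F' t` is determined by
the boundary values of `F.im`. -/
theorem tendsto_integral_im_div_sq {F : ℂ → ℂ} {U : Set ℂ} {t d C R₀ : ℝ}
    (hc : ContinuousOn F {z | 0 ≤ z.im}) (hd : DifferentiableOn ℂ F {z | 0 < z.im})
    (hU : IsOpen U) (htU : (t : ℂ) ∈ U) (hdU : DifferentiableOn ℂ F U)
    (hF't : deriv F t = d) (hFt : (F t).im = 0)
    (hF : ∀ z : ℂ, 0 < z.im → R₀ ≤ ‖z‖ → ‖F z - z‖ ≤ C) :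
    (∀ p q : ℝ, IntervalIntegrable (fun x : ℝ => (F x).im / (x - t) ^ 2) volume p q) ∧
    Tendsto (fun R : ℝ => ∫ x in -R..R, (F x).im / (x - t) ^ 2) atTop
      (𝓝 (Real.pi * (d - 1))) := by
  set K : ℂ → ℂ := dslope (dslope F t) t with hK
  have hUt : U ∈ 𝓝 (t : ℂ) := hU.mem_nhds htU
  have hKU : DifferentiableOn ℂ K U :=
    (Complex.differentiableOn_dslope hUt).2 ((Complex.differentiableOn_dslope hUt).2 hdU)
  have hKc : ContinuousOn K {z | 0 ≤ z.im} := by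
    intro z hz
    by_cases h : z = t
    · subst h
      exact (hKU.continuousOn.continuousAt hUt).continuousWithinAt
    · exact (continuousWithinAt_dslope_of_ne h).2 ((continuousWithinAt_dslope_of_ne h).2 (hc z hz))
  have hKd : ∀ z : ℂ, 0 < z.im → DifferentiableAt ℂ K z := by
    intro z hz
    have h : z ≠ t := by rintro rfl; simp at hz
    exact (differentiableAt_dslope_of_ne h).2 ((differentiableAt_dslope_of_ne h).2
      ((hd z hz).differentiableAt ((isOpen_lt continuous_const continuous_im).mem_nhds hz)))
  have hKval : ∀ z : ℂ, z ≠ t → K z = (F z - F t - d * (z - t)) / (z - t) ^ 2 := by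
    intro z hz
    have hz' : z - t ≠ 0 := sub_ne_zero.2 hz
    rw [hK, dslope_of_ne _ hz, slope_def_field, dslope_of_ne _ hz, slope_def_field, dslope_same,
      hF't]
    field_simp
  have hKim : ∀ x : ℝ, x ≠ t → (K x).im = (F x).im / (x - t) ^ 2 := by
    intro x hx
    rw [hKval x (by exact_mod_cast hx)]
    rw [← ofReal_sub, ← ofReal_pow, div_ofReal_im]
    simp [hFt]
  have hKr : Continuous fun x : ℝ => (K x).im := by
    refine continuous_im.comp (hKc.comp_continuous continuous_ofReal ?_)
    simp
  have hae : ∀ᵐ x : ℝ, (K x).im = (F x).im / (x - t) ^ 2 := by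
    filter_upwards [(Set.finite_singleton t).countable.ae_notMem volume] with x hx
    exact hKim x hx
  refine ⟨fun p q => (hKr.intervalIntegrable p q).congr_ae (ae_restrict_of_ae hae), ?_⟩
  have hne : ∀ z : ℂ, 0 ≤ z.im → z + I ≠ 0 := by
    intro z hz h
    have := congrArg Complex.im h
    simp at this
    linarith
  set M : ℂ → ℂ := fun z => K z - (1 - d) / (z + I) with hM
  have hMc : ContinuousOn M {z | 0 ≤ z.im} :=
    hKc.sub (continuousOn_const.div (by fun_prop) hne)
  have hMd : ∀ z : ℂ, 0 < z.im → DifferentiableAt ℂ M z := fun z hz =>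
    (hKd z hz).sub ((differentiableAt_const _).div (by fun_prop) (hne z hz.le))
  obtain ⟨B, hB⟩ : ∃ B : ℝ, ∀ R : ℝ, R₀ ≤ R → 2 * |t| ≤ R → 0 < R → ∀ z : ℂ, 0 < z.im → R ≤ ‖z‖ →
      ‖M z‖ ≤ B / R ^ 2 := by
    refine ⟨4 * (C + ‖(t : ℂ) - F t‖) + 2 * ‖(1 - d : ℂ) * (t + I)‖, ?_⟩
    intro R hR0 hRt hR z hz hzR
    have h1 : z ≠ t := by rintro rfl; simp at hz
    have hz' : z - t ≠ 0 := sub_ne_zero.2 h1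
    have h2 := hne z hz.le
    have e : M z = ((F z - z) + (t - F t)) / (z - t) ^ 2
        + (1 - d) * (t + I) / ((z - t) * (z + I)) := by
      simp only [hM]
      rw [hKval z h1]
      field_simp
      ring
    have b1 : R / 2 ≤ ‖z - t‖ := by
      have := norm_sub_norm_le z (t : ℂ)
      rw [norm_real, Real.norm_eq_abs] at this
      linarith
    have b2 : R ≤ ‖z + I‖ := by
      refine hzR.trans ?_
      rw [← abs_of_nonneg (norm_nonneg z), ← abs_of_nonneg (norm_nonneg (z + I)), ← sq_le_sq,
        Complex.sq_norm, Complex.sq_norm, normSq_apply, normSq_apply]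
      simp
      nlinarith
    have b3 := hF z hz (hR0.trans hzR)
    have b4 : ‖(F z - z) + (t - F t)‖ ≤ C + ‖(t : ℂ) - F t‖ := (norm_add_le _ _).trans (by gcongr)
    have c1 : ‖((F z - z) + (t - F t)) / (z - t) ^ 2‖ ≤ (C + ‖(t : ℂ) - F t‖) / (R / 2) ^ 2 := by
      rw [norm_div, norm_pow]
      have : 0 ≤ C + ‖(t : ℂ) - F t‖ := (norm_nonneg _).trans b4
      gcongr
    have c2 : ‖(1 - d) * (t + I) / ((z - t) * (z + I))‖ ≤ ‖(1 - d : ℂ) * (t + I)‖ / (R / 2 * R) := by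
      rw [norm_div, norm_mul (z - t : ℂ)]
      gcongr
    rw [e]
    refine (norm_add_le _ _).trans ((add_le_add c1 c2).trans (le_of_eq ?_))
    field_simp
    ring
  have hlim : Tendsto (fun R : ℝ => ∫ x in -R..R, M x) atTop (𝓝 0) := by
    have hz : Tendsto (fun R : ℝ => 4 * B / R) atTop (𝓝 0) := tendsto_const_nhds.div_atTop tendsto_id
    refine squeeze_zero_norm' ?_ hz
    filter_upwards [eventually_ge_atTop R₀, eventually_ge_atTop (2 * |t|), eventually_gt_atTop 0]
      with R h1 h2 h3
    have hb := hB R h1 h2 h3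
    have key := integral_boundary_rect_eq_zero_of_continuousOn_of_differentiableOn M
      ((-R : ℝ) : ℂ) (R + R * I) (hMc.mono ?_) ?_
    · simp only [ofReal_re, ofReal_im, add_re, add_im, mul_re, mul_im, I_re, I_im, mul_zero,
        mul_one, sub_zero, zero_add, add_zero, ofReal_zero, zero_mul] at key
      have k1 : ‖∫ x in -R..R, M (x + R * I)‖ ≤ B / R ^ 2 * |R - -R| := by
        refine intervalIntegral.norm_integral_le_of_norm_le_const fun x _ => hb _ (by simpa) ?_
        refine le_trans ?_ (abs_im_le_norm _)
        simp [le_abs_self]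
      have k2 : ‖∫ y in (0 : ℝ)..R, M (R + y * I)‖ ≤ B / R ^ 2 * |R - 0| := by
        refine intervalIntegral.norm_integral_le_of_norm_le_const fun y hy => hb _ ?_ ?_
        · rw [uIoc_of_le h3.le] at hy
          simpa using hy.1
        · refine le_trans ?_ (abs_re_le_norm _)
          simp [le_abs_self]
      have k3 : ‖∫ y in (0 : ℝ)..R, M ((-R : ℝ) + y * I)‖ ≤ B / R ^ 2 * |R - 0| := by
        refine intervalIntegral.norm_integral_le_of_norm_le_const fun y hy => hb _ ?_ ?_
        · rw [uIoc_of_le h3.le] at hy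
          simpa using hy.1
        · refine le_trans ?_ (abs_re_le_norm _)
          simp [le_abs_self]
      have e : (∫ x in -R..R, M x) = (∫ x in -R..R, M (x + R * I))
          - I • (∫ y in (0 : ℝ)..R, M (R + y * I)) + I • (∫ y in (0 : ℝ)..R, M ((-R : ℝ) + y * I)) := by
        linear_combination key
      rw [e]
      refine (norm_add_le _ _).trans ((add_le_add (norm_sub_le _ _) le_rfl).trans ?_)
      rw [norm_smul, norm_smul, norm_I, one_mul, one_mul]
      refine (add_le_add (add_le_add k1 k2) k3).trans (le_of_eq ?_)
      rw [abs_of_pos (by linarith), abs_of_pos (by linarith)]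
      field_simp
      ring
    · intro z hz
      have := hz.2
      simp [h3.le] at this
      exact this.1
    · intro z hz
      have := hz.2
      simp [h3.le] at this
      exact (hMd z this.1).differentiableWithinAt
  have hMr : Continuous fun x : ℝ => M x := hMc.comp_continuous continuous_ofReal (by simp)
  have hMim : ∀ x : ℝ, (M x).im = (K x).im + (1 - d) * (1 / (1 + x ^ 2)) := by
    intro x
    have : ((1 - d : ℂ) / (x + I)).im = -((1 - d) * (1 / (1 + x ^ 2))) := by
      rw [div_im]
      simp [normSq_apply]
      ring
    simp only [hM, sub_im]
    rw [this]
    ring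
  have hval : ∀ R : ℝ, (∫ x in -R..R, (F x).im / (x - t) ^ 2)
      = (∫ x in -R..R, M x).im - (1 - d) * (2 * Real.arctan R) := by
    intro R
    have e1 : (∫ x in -R..R, M x).im = ∫ x in -R..R, (M x).im :=
      (imCLM.intervalIntegral_comp_comm (hMr.intervalIntegrable _ _)).symm
    have e2 : (∫ x in -R..R, (F x).im / (x - t) ^ 2) = ∫ x in -R..R, (K x).im := by
      refine intervalIntegral.integral_congr_ae ?_
      filter_upwards [hae] with x hx _ using hx.symm
    have hi : Continuous fun x : ℝ => (1 - d) * (1 / (1 + x ^ 2)) :=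
      continuous_const.mul (continuous_const.div (by fun_prop) fun x => by positivity)
    rw [e1, e2]
    simp_rw [hMim]
    rw [intervalIntegral.integral_add (hKr.intervalIntegrable _ _) (hi.intervalIntegrable _ _),
      intervalIntegral.integral_const_mul, integral_one_div_one_add_sq, Real.arctan_neg]
    ring
  simp_rw [hval]
  have h1 := ((continuous_im.tendsto _).comp hlim).sub
    (((Real.tendsto_arctan_atTop.mono_right nhdsWithin_le_nhds).const_mul 2).const_mul (1 - d))
  have h2 : (0 : ℂ).im - (1 - d) * (2 * (Real.pi / 2)) = Real.pi * (d - 1) := by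
    rw [zero_im]
    ring
  rwa [h2] at h1

theorem continuousOn_cpow_const_im_nonneg {c : ℂ} (hc : 0 < c.re) :
    ContinuousOn (fun z : ℂ => z ^ c) {z | 0 ≤ z.im} := by
  intro z hz
  rcases eq_or_ne z 0 with rfl | h0
  · exact ((continuousAt_cpow_zero_of_re_pos hc).comp
      (f := fun z : ℂ => (z, c)) (by fun_prop)).continuousWithinAt
  have hlog : ContinuousWithinAt log {z : ℂ | 0 ≤ z.im} z := by
    by_cases hs : z ∈ slitPlane
    · exact (continuousAt_clog hs).continuousWithinAt
    · rw [mem_slitPlane_iff, not_or, not_lt, not_not] at hs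
      refine continuousWithinAt_log_of_re_neg_of_im_zero (lt_of_le_of_ne hs.1 fun h => h0 ?_) hs.2
      exact Complex.ext h hs.2
  refine ((hlog.mul continuousWithinAt_const).cexp).congr_of_eventuallyEq ?_ (cpow_def_of_ne_zero h0 c)
  filter_upwards [mem_nhdsWithin_of_mem_nhds (isOpen_ne.mem_nhds h0)] with w hw
  exact cpow_def_of_ne_zero hw c

theorem norm_log_add_sub_log_le {z : ℂ} {b : ℝ} (hb : 0 ≤ b) (hz : 0 < z.im) (h : 2 * b ≤ ‖z‖) :
    ‖log (z + b) - log z‖ ≤ 2 * b / ‖z‖ := by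
  have hz0 : 0 < ‖z‖ := norm_pos_iff.2 (by rintro rfl; simp at hz)
  have := Convex.norm_image_sub_le_of_norm_hasDerivWithin_le (s := Icc (0 : ℝ) b)
    (f := fun u : ℝ => log (z + u)) (f' := fun u : ℝ => 1 / (z + u)) (C := 2 / ‖z‖) (x := 0) (y := b)
    (fun u _ => by
      have h1 : HasDerivAt (fun u : ℝ => z + (u : ℂ)) 1 u :=
        (ofRealCLM.hasDerivAt (x := u)).const_add z
      exact (h1.clog_real (Or.inr (by simpa using hz.ne'))).hasDerivWithinAt)
    (fun u hu => by
      have h2 : ‖z‖ / 2 ≤ ‖z + u‖ := by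
        have := norm_sub_le_norm_add z (u : ℂ)
        rw [norm_real, Real.norm_of_nonneg hu.1] at this
        linarith [hu.2]
      rw [norm_div, norm_one, show 2 / ‖z‖ = 1 / (‖z‖ / 2) by field_simp]
      gcongr)
    (convex_Icc 0 b) ⟨le_rfl, hb⟩ ⟨hb, le_rfl⟩
  simp only [ofReal_zero, add_zero, sub_zero, Real.norm_of_nonneg hb] at this
  exact this.trans (le_of_eq (by ring))

/-- The holomorphic geometric mean of `z + a 1, …, z + a n`. -/
noncomputable def complexGeomMean (n : ℕ) (a : ℕ → ℝ) (z : ℂ) : ℂ :=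
  ∏ k ∈ Finset.Icc 1 n, (z + a k) ^ ((n : ℂ)⁻¹)

theorem inv_natCast_re_pos {n : ℕ} (hn : 0 < n) : 0 < ((n : ℂ)⁻¹).re := by
  rw [← ofReal_natCast, ← ofReal_inv, ofReal_re]
  positivity

theorem continuousOn_complexGeomMean {n : ℕ} (hn : 0 < n) (a : ℕ → ℝ) :
    ContinuousOn (complexGeomMean n a) {z | 0 ≤ z.im} := by
  refine continuousOn_finsetProd _ fun k _ => ?_
  exact (continuousOn_cpow_const_im_nonneg (inv_natCast_re_pos hn)).comp
    (f := fun z : ℂ => z + a k) (by fun_prop) (fun z hz => by simpa using hz)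

theorem differentiableAt_complexGeomMean {n : ℕ} {a : ℕ → ℝ} {z : ℂ}
    (hz : ∀ k ∈ Finset.Icc 1 n, z + a k ∈ slitPlane) :
    DifferentiableAt ℂ (complexGeomMean n a) z := by
  refine DifferentiableAt.fun_finsetProd fun k hk => ?_
  exact (differentiableAt_id.add_const _).cpow_const (hz k hk)

theorem norm_complexGeomMean_sub_le {n : ℕ} (hn : 0 < n) {a : ℕ → ℝ} {b : ℝ}
    (ha : ∀ k ∈ Finset.Icc 1 n, 0 ≤ a k) (hab : ∀ k ∈ Finset.Icc 1 n, a k ≤ b) {z : ℂ}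
    (hz : 0 < z.im) (hbz : 2 * b ≤ ‖z‖) : ‖complexGeomMean n a z - z‖ ≤ 4 * b := by
  have hz00 : z ≠ 0 := by rintro rfl; simp at hz
  have hz0 : 0 < ‖z‖ := norm_pos_iff.2 hz00
  have hn' : (0 : ℝ) < n := by exact_mod_cast hn
  set w : ℂ := ∑ k ∈ Finset.Icc 1 n, (log (z + a k) - log z) * (n : ℂ)⁻¹ with hw
  have hF : complexGeomMean n a z = z * exp w := by
    have h1 : ∀ k ∈ Finset.Icc 1 n, (z + a k) ^ ((n : ℂ)⁻¹)
        = z ^ ((n : ℂ)⁻¹) * exp ((log (z + a k) - log z) * (n : ℂ)⁻¹) := by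
      intro k _
      have hne : z + a k ≠ 0 := fun h => by
        have := congrArg Complex.im h
        simp [hz.ne'] at this
      rw [cpow_def_of_ne_zero hne, cpow_def_of_ne_zero hz00, ← exp_add]
      congr 1
      ring
    rw [complexGeomMean, Finset.prod_congr rfl h1, Finset.prod_mul_distrib, Finset.prod_const,
      Nat.card_Icc, Nat.add_sub_cancel, cpow_nat_inv_pow _ hn.ne', ← exp_sum]
  have hwn : ‖w‖ ≤ 2 * b / ‖z‖ := by
    calc ‖w‖ ≤ ∑ k ∈ Finset.Icc 1 n, 2 * b / ‖z‖ * (n : ℝ)⁻¹ := by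
          refine norm_sum_le_of_le _ fun k hk => ?_
          rw [norm_mul, norm_inv, norm_natCast]
          gcongr
          refine (norm_log_add_sub_log_le (ha k hk) hz (by linarith [hab k hk])).trans ?_
          gcongr
          exact hab k hk
      _ = 2 * b / ‖z‖ := by
          rw [Finset.sum_const, Nat.card_Icc, Nat.add_sub_cancel, nsmul_eq_mul]
          field_simp
  have hw1 : ‖w‖ ≤ 1 := hwn.trans ((div_le_one hz0).2 hbz)
  calc ‖complexGeomMean n a z - z‖ = ‖z‖ * ‖exp w - 1‖ := by
        rw [hF, ← norm_mul]
        ring_nf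
    _ ≤ ‖z‖ * (2 * (2 * b / ‖z‖)) := by
        gcongr
        exact (norm_exp_sub_one_le hw1).trans (by gcongr)
    _ = 4 * b := by field_simp; ring

theorem complexGeomMean_neg_ofReal_im (n : ℕ) (a : ℕ → ℝ) (s : ℝ) :
    (complexGeomMean n a ((-s : ℝ) : ℂ)).im = (∏ k ∈ Finset.Icc 1 n, |a k - s|) ^ ((n : ℝ)⁻¹) *
      Real.sin (((Finset.Icc 1 n).filter fun k => a k < s).card * Real.pi / n) := by
  have h : ∀ k ∈ Finset.Icc 1 n, (((-s : ℝ) : ℂ) + a k) ^ ((n : ℂ)⁻¹)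
      = ((|a k - s| ^ ((n : ℝ)⁻¹) : ℝ) : ℂ) *
        if a k < s then exp (Real.pi * I * (n : ℂ)⁻¹) else 1 := by
    intro k _
    rw [← ofReal_add, ofReal_cpow (abs_nonneg _)]
    push_cast
    split_ifs with hk
    · rw [← ofReal_neg, ← ofReal_add, ofReal_cpow_of_nonpos (by linarith), abs_of_neg (by linarith)]
      congr 2
      push_cast
      ring
    · rw [abs_of_nonneg (by linarith), mul_one]
      congr 1
      push_cast
      ring
  rw [complexGeomMean, Finset.prod_congr rfl h, Finset.prod_mul_distrib, ← ofReal_prod,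
    Real.finsetProd_rpow _ _ fun _ _ => abs_nonneg _, im_ofReal_mul, ← Finset.prod_filter,
    Finset.prod_const, ← exp_nat_mul]
  congr 1
  rw [← exp_ofReal_mul_I_im]
  congr 2
  push_cast
  ring

theorem complexGeomMean_ofReal {n : ℕ} {a : ℕ → ℝ} {t : ℝ}
    (ht : ∀ k ∈ Finset.Icc 1 n, 0 ≤ a k + t) :
    complexGeomMean n a t = (((∏ k ∈ Finset.Icc 1 n, (a k + t)) ^ ((n : ℝ)⁻¹) : ℝ) : ℂ) := by
  rw [← Real.finsetProd_rpow _ _ ht, ofReal_prod]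
  refine Finset.prod_congr rfl fun k hk => ?_
  rw [ofReal_cpow (ht k hk)]
  push_cast
  rw [add_comm]

theorem le_of_forall_le_succ {n : ℕ} {a : ℕ → ℝ}
    (hmono : ∀ k ∈ Finset.Icc 1 (n - 1), a k ≤ a (k + 1)) (i j : ℕ) (hi : 1 ≤ i) (hij : i ≤ j)
    (hj : j ≤ n) : a i ≤ a j := by
  induction j, hij using Nat.le_induction with
  | base => exact le_rfl
  | succ j hij ih =>
    exact (ih (by omega)).trans (hmono j (Finset.mem_Icc.2 ⟨by omega, by omega⟩))

theorem hasDerivAt_geomMean {n : ℕ} (hn : 0 < n) {a : ℕ → ℝ}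
    (hpos : ∀ k ∈ Finset.Icc 1 n, 0 < a k)
    (hmono : ∀ k ∈ Finset.Icc 1 (n - 1), a k ≤ a (k + 1)) {t : ℝ} (ht : -a 1 < t) :
    HasDerivAt (fun t : ℝ => (∏ k ∈ Finset.Icc 1 n, (a k + t)) ^ ((n : ℝ)⁻¹))
      (1 + (1 / Real.pi) * ∑ ℓ ∈ Finset.Icc 1 (n - 1),
        Real.sin (ℓ * Real.pi / n) *
          ∫ s in (a ℓ)..(a (ℓ + 1)),
            (∏ k ∈ Finset.Icc 1 n, |a k - s|) ^ ((n : ℝ)⁻¹) / (s + t) ^ 2) t := by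
  have hn0 : (n : ℝ) ≠ 0 := by exact_mod_cast hn.ne'
  have hle := le_of_forall_le_succ hmono
  set F := complexGeomMean n a with hF
  set U : Set ℂ := {z | -a 1 < z.re} with hU
  have hUo : IsOpen U := isOpen_lt continuous_const continuous_re
  have hdU : ∀ z ∈ U, DifferentiableAt ℂ F z := fun z hz =>
    differentiableAt_complexGeomMean fun k hk => by
      have h1 := hle 1 k le_rfl (Finset.mem_Icc.1 hk).1 (Finset.mem_Icc.1 hk).2
      have h2 : -a 1 < z.re := hz
      exact Or.inl (by simp; linarith)
  have hdI : DifferentiableOn ℂ F {z | 0 < z.im} := fun z hz =>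
    (differentiableAt_complexGeomMean fun k _ => Or.inr (by
      have h2 : 0 < z.im := hz
      simpa using h2.ne')).differentiableWithinAt
  have hreal : ∀ x : ℝ, -a 1 < x →
      F x = (((∏ k ∈ Finset.Icc 1 n, (a k + x)) ^ ((n : ℝ)⁻¹) : ℝ) : ℂ) := fun x hx =>
    complexGeomMean_ofReal fun k hk => by
      have h1 := hle 1 k le_rfl (Finset.mem_Icc.1 hk).1 (Finset.mem_Icc.1 hk).2
      linarith
  have htU : (t : ℂ) ∈ U := by simpa [hU] using ht
  have hFD := (hdU t htU).hasDerivAt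
  have hev : ∀ᶠ x : ℝ in 𝓝 t, -a 1 < x := Ioi_mem_nhds ht
  have hf : HasDerivAt (fun t : ℝ => (∏ k ∈ Finset.Icc 1 n, (a k + t)) ^ ((n : ℝ)⁻¹))
      (deriv F t).re t :=
    hFD.real_of_complex.congr_of_eventuallyEq (hev.mono fun x hx => by simp only [hreal x hx, ofReal_re])
  have hDre : deriv F t = ((deriv F t).re : ℂ) :=
    (hFD.comp_ofReal).unique
      (hf.ofReal_comp.congr_of_eventuallyEq (hev.mono fun x hx => hreal x hx))
  obtain ⟨hint, hlim⟩ := tendsto_integral_im_div_sq (continuousOn_complexGeomMean hn a) hdI hUo htU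
    (fun z hz => (hdU z hz).differentiableWithinAt) hDre (by rw [← hF, hreal t ht, ofReal_im])
    fun z hz hbz => norm_complexGeomMean_sub_le hn (fun k hk => (hpos k hk).le)
      (fun k hk => hle k n (Finset.mem_Icc.1 hk).1 (Finset.mem_Icc.1 hk).2 le_rfl) hz hbz
  set g : ℝ → ℝ := fun s => (F ((-s : ℝ) : ℂ)).im / (s + t) ^ 2 with hg
  have hgF : g = fun s => (fun x : ℝ => (F x).im / (x - t) ^ 2) (-s) := by
    funext s
    simp only [hg]
    congr 1
    ring
  have hgi : ∀ p q, IntervalIntegrable g volume p q := fun p q => by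
    rw [hgF, IntervalIntegrable.iff_comp_neg]
    simpa using hint (-p) (-q)
  have hgm : ∀ s, g s = (∏ k ∈ Finset.Icc 1 n, |a k - s|) ^ ((n : ℝ)⁻¹) *
      Real.sin (((Finset.Icc 1 n).filter fun k => a k < s).card * Real.pi / n) / (s + t) ^ 2 :=
    fun s => by rw [hg, ← complexGeomMean_neg_ofReal_im]
  have hmid : ∀ ℓ ∈ Finset.Icc 1 (n - 1), ∫ s in (a ℓ)..(a (ℓ + 1)), g s
      = Real.sin (ℓ * Real.pi / n) * ∫ s in (a ℓ)..(a (ℓ + 1)),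
          (∏ k ∈ Finset.Icc 1 n, |a k - s|) ^ ((n : ℝ)⁻¹) / (s + t) ^ 2 := by
    intro ℓ hℓ
    have hℓ' := Finset.mem_Icc.1 hℓ
    rw [← intervalIntegral.integral_const_mul]
    refine intervalIntegral.integral_congr_Ioo_of_le (hmono ℓ hℓ) fun s hs => ?_
    have hfil : ((Finset.Icc 1 n).filter fun k => a k < s) = Finset.Icc 1 ℓ := by
      ext k
      simp only [Finset.mem_filter, Finset.mem_Icc]
      refine ⟨fun ⟨h1, h2⟩ => ⟨h1.1, ?_⟩, fun h => ⟨⟨h.1, by omega⟩, ?_⟩⟩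
      · by_contra! h3
        have := hle (ℓ + 1) k (by omega) (by omega) h1.2
        linarith [hs.2]
      · have := hle k ℓ h.1 h.2 (by omega)
        linarith [hs.1]
    simp only [hgm, hfil, Nat.card_Icc, Nat.add_sub_cancel]
    ring
  have hleft : ∀ R : ℝ, -a 1 < R → ∫ s in -R..(a 1), g s = 0 := by
    intro R hR
    rw [← intervalIntegral.integral_zero (a := -R) (b := a 1) (μ := volume)]
    refine intervalIntegral.integral_congr_Ioo_of_le (by linarith) fun s hs => ?_
    have hfil : ((Finset.Icc 1 n).filter fun k => a k < s) = ∅ := by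
      refine Finset.filter_eq_empty_iff.2 fun k hk => ?_
      have h1 := hle 1 k le_rfl (Finset.mem_Icc.1 hk).1 (Finset.mem_Icc.1 hk).2
      linarith [hs.2]
    simp [hgm, hfil]
  have hright : ∀ R : ℝ, a n < R → ∫ s in (a n)..R, g s = 0 := by
    intro R hR
    rw [← intervalIntegral.integral_zero (a := a n) (b := R) (μ := volume)]
    refine intervalIntegral.integral_congr_Ioo_of_le hR.le fun s hs => ?_
    have hfil : ((Finset.Icc 1 n).filter fun k => a k < s) = Finset.Icc 1 n := by
      refine Finset.filter_eq_self.2 fun k hk => ?_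
      have h1 := hle k n (Finset.mem_Icc.1 hk).1 (Finset.mem_Icc.1 hk).2 le_rfl
      linarith [hs.1]
    simp only [hgm, hfil, Nat.card_Icc, Nat.add_sub_cancel]
    rw [mul_div_cancel_left₀ _ hn0, Real.sin_pi, mul_zero, zero_div]
  have hIco : Finset.Icc 1 (n - 1) = Finset.Ico 1 n := by
    ext k
    simp only [Finset.mem_Icc, Finset.mem_Ico]
    omega
  have hval : ∀ R : ℝ, -a 1 < R → a n < R → ∫ x in -R..R, (F x).im / (x - t) ^ 2
      = ∑ ℓ ∈ Finset.Icc 1 (n - 1), Real.sin (ℓ * Real.pi / n) * ∫ s in (a ℓ)..(a (ℓ + 1)),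
          (∏ k ∈ Finset.Icc 1 n, |a k - s|) ^ ((n : ℝ)⁻¹) / (s + t) ^ 2 := by
    intro R h1 h2
    rw [← Finset.sum_congr rfl hmid, hIco,
      intervalIntegral.sum_integral_adjacent_intervals_Ico hn fun _ _ => hgi _ _]
    have e1 : ∫ s in -R..R, g s = ∫ x in -R..R, (F x).im / (x - t) ^ 2 := by
      rw [hgF, intervalIntegral.integral_comp_neg, neg_neg]
    rw [← e1, ← intervalIntegral.integral_add_adjacent_intervals (hgi (-R) (a 1)) (hgi (a 1) R),
      ← intervalIntegral.integral_add_adjacent_intervals (hgi (a 1) (a n)) (hgi (a n) R),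
      hleft R h1, hright R h2, zero_add, add_zero]
  have hfin := tendsto_nhds_unique hlim (tendsto_const_nhds.congr' (by
    filter_upwards [eventually_gt_atTop (-a 1), eventually_gt_atTop (a n)] with R h1 h2
    exact (hval R h1 h2).symm))
  rw [← hfin]
  convert hf using 1
  field_simp
  ring

theorem hasDerivAt_integral_div_add_pow {w : ℝ → ℝ} (hw : Continuous w) {p q t : ℝ} (hpq : p ≤ q)
    (ht : -p < t) (m : ℕ) :
    HasDerivAt (fun t : ℝ => ∫ s in p..q, w s / (s + t) ^ m)
      (-(m * ∫ s in p..q, w s / (s + t) ^ (m + 1))) t := by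
  have hε : 0 < (p + t) / 2 := by linarith
  have hlow : ∀ x ∈ Ioi (t - (p + t) / 2), ∀ s ∈ Icc p q, (p + t) / 2 ≤ s + x := by
    intro x hx s hs
    have := mem_Ioi.1 hx
    linarith [hs.1]
  have htm : t ∈ Ioi (t - (p + t) / 2) := mem_Ioi.2 (by linarith)
  have hcont : ∀ j : ℕ, ∀ x ∈ Ioi (t - (p + t) / 2),
      ContinuousOn (fun s => w s / (s + x) ^ j) (uIcc p q) := by
    intro j x hx
    rw [uIcc_of_le hpq]
    refine hw.continuousOn.div (by fun_prop) fun s hs => pow_ne_zero _ ?_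
    exact (hε.trans_le (hlow x hx s hs)).ne'
  have key := intervalIntegral.hasDerivAt_integral_of_dominated_loc_of_deriv_le
    (μ := volume) (a := p) (b := q) (F := fun x s => w s / (s + x) ^ m)
    (F' := fun x s => -(m * (w s / (s + x) ^ (m + 1)))) (x₀ := t)
    (bound := fun s => m * (|w s| / ((p + t) / 2) ^ (m + 1)))
    (s := Ioi (t - (p + t) / 2)) (Ioi_mem_nhds htm) ?_
    (hcont m t htm).intervalIntegrable ?_ ?_ ?_ ?_
  · have := key.2
    rwa [intervalIntegral.integral_neg, intervalIntegral.integral_const_mul] at this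
  · filter_upwards [Ioi_mem_nhds htm] with x hx
    exact (hcont m x hx).intervalIntegrable.aestronglyMeasurable_restrict_uIoc
  · exact ((hcont (m + 1) t htm).intervalIntegrable.const_mul _).neg.aestronglyMeasurable_restrict_uIoc
  · refine Eventually.of_forall fun s hs x hx => ?_
    rw [uIoc_of_le hpq] at hs
    have h1 := hlow x hx s ⟨hs.1.le, hs.2⟩
    rw [norm_neg, norm_mul, norm_div, norm_pow, Real.norm_natCast, Real.norm_eq_abs,
      Real.norm_of_nonneg (hε.le.trans h1)]
    gcongr
  · exact (by fun_prop : Continuous _).intervalIntegrable _ _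
  · refine Eventually.of_forall fun s hs x hx => ?_
    rw [uIoc_of_le hpq] at hs
    have h0 : s + x ≠ 0 := (hε.trans_le (hlow x hx s ⟨hs.1.le, hs.2⟩)).ne'
    have h2 := (((hasDerivAt_id x).const_add s).pow m).inv (pow_ne_zero m h0)
    have h3 := h2.const_mul (w s)
    refine h3.congr_deriv ?_
    simp only [id, Pi.pow_apply]
    rcases m with _ | m
    · simp
    · rw [Nat.add_sub_cancel]
      field_simp
      ring

theorem iteratedDeriv_sum_integral_div_add_sq {ι : Type*} (S : Finset ι) {p q : ι → ℝ} {w : ℝ → ℝ}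
    {V : Set ℝ} (hV : IsOpen V) (hw : Continuous w) (hpq : ∀ i ∈ S, p i ≤ q i)
    (hlow : ∀ i ∈ S, ∀ x ∈ V, -p i < x) (A b : ℝ) (c : ι → ℝ) (m : ℕ) :
    ∀ t ∈ V, iteratedDeriv m
      (fun t : ℝ => A + b * ∑ i ∈ S, c i * ∫ s in (p i)..(q i), w s / (s + t) ^ 2) t
        = (if m = 0 then A else 0) + b * ((-1) ^ m * ((m + 1).factorial *
            ∑ i ∈ S, c i * ∫ s in (p i)..(q i), w s / (s + t) ^ (m + 2))) := by
  induction m with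
  | zero => intro t _; simp
  | succ m ih =>
    intro t ht
    rw [iteratedDeriv_succ, (Filter.eventuallyEq_of_mem (hV.mem_nhds ht) ih).deriv_eq]
    refine (((((HasDerivAt.fun_sum fun i hi => (hasDerivAt_integral_div_add_pow hw (hpq i hi)
      (hlow i hi t ht) (m + 2)).const_mul (c i)).const_mul _).const_mul _).const_mul b).const_add
        _).deriv.trans ?_
    simp only [Nat.add_eq_zero_iff, one_ne_zero, and_false, if_false, zero_add]
    simp_rw [mul_neg, Finset.sum_neg_distrib, mul_left_comm (c _), ← Finset.mul_sum]
    rw [Nat.factorial_succ (m + 1)]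
    push_cast
    ring

end

/-- For `0 < a 1 ≤ … ≤ a n` not all equal and `t > -a 1`, the geometric mean
`G_n(a+t) = (∏ (a_k+t))^{1/n}` has derivative
`1 + (1/π) ∑_{ℓ=1}^{n-1} sin(ℓπ/n) ∫_{a_ℓ}^{a_{ℓ+1}} (∏ |a_k-s|)^{1/n} ds/(s+t)^2`,
and consequently `G_n(a+t)` is a Bernstein function on `(-a 1, ∞)`. -/
theorem geometric_mean_bernstein (n : ℕ) (hn : 0 < n) (a : ℕ → ℝ)
    (hpos : ∀ k ∈ Finset.Icc 1 n, 0 < a k)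
    (hmono : ∀ k ∈ Finset.Icc 1 (n - 1), a k ≤ a (k + 1))
    (hne : ∃ i ∈ Finset.Icc 1 n, ∃ j ∈ Finset.Icc 1 n, a i ≠ a j) :
    (∀ t ∈ Set.Ioi (-a 1),
      deriv (fun t : ℝ => (∏ k ∈ Finset.Icc 1 n, (a k + t)) ^ ((n : ℝ)⁻¹)) t
        = 1 + (1 / Real.pi) * ∑ ℓ ∈ Finset.Icc 1 (n - 1),
            Real.sin (ℓ * Real.pi / n) *
              ∫ s in (a ℓ)..(a (ℓ + 1)),
                (∏ k ∈ Finset.Icc 1 n, |a k - s|) ^ ((n : ℝ)⁻¹) / (s + t) ^ 2) ∧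
    (∀ t ∈ Set.Ioi (-a 1),
      0 ≤ (∏ k ∈ Finset.Icc 1 n, (a k + t)) ^ ((n : ℝ)⁻¹)) ∧
    (∀ m : ℕ, ∀ t ∈ Set.Ioi (-a 1),
      0 ≤ (-1 : ℝ) ^ m *
        iteratedDeriv m
          (deriv (fun t : ℝ => (∏ k ∈ Finset.Icc 1 n, (a k + t)) ^ ((n : ℝ)⁻¹))) t) := by
  have hle := le_of_forall_le_succ hmono
  have hderiv : ∀ t ∈ Set.Ioi (-a 1),
      deriv (fun t : ℝ => (∏ k ∈ Finset.Icc 1 n, (a k + t)) ^ ((n : ℝ)⁻¹)) t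
        = 1 + (1 / Real.pi) * ∑ ℓ ∈ Finset.Icc 1 (n - 1),
            Real.sin (ℓ * Real.pi / n) *
              ∫ s in (a ℓ)..(a (ℓ + 1)),
                (∏ k ∈ Finset.Icc 1 n, |a k - s|) ^ ((n : ℝ)⁻¹) / (s + t) ^ 2 :=
    fun t ht => (hasDerivAt_geomMean hn hpos hmono ht).deriv
  refine ⟨hderiv, fun t ht => Real.rpow_nonneg (Finset.prod_nonneg fun k hk => ?_) _,
    fun m t ht => ?_⟩
  · have h1 := hle 1 k le_rfl (Finset.mem_Icc.1 hk).1 (Finset.mem_Icc.1 hk).2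
    linarith [Set.mem_Ioi.1 ht]
  have hw : Continuous fun s : ℝ => (∏ k ∈ Finset.Icc 1 n, |a k - s|) ^ ((n : ℝ)⁻¹) :=
    Continuous.rpow_const (by fun_prop) fun _ => Or.inr (by positivity)
  have hsin : ∀ ℓ ∈ Finset.Icc 1 (n - 1), 0 ≤ Real.sin (ℓ * Real.pi / n) := by
    intro ℓ hℓ
    have hℓn : (ℓ : ℝ) ≤ n := by
      have := (Finset.mem_Icc.1 hℓ).2
      exact_mod_cast (by omega : ℓ ≤ n)
    have hn0 : (0 : ℝ) < n := by exact_mod_cast hn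
    refine Real.sin_nonneg_of_nonneg_of_le_pi (by positivity) ?_
    rw [div_le_iff₀ hn0, mul_comm]
    gcongr
  have hlow : ∀ ℓ ∈ Finset.Icc 1 (n - 1), ∀ x ∈ Set.Ioi (-a 1), -a ℓ < x := by
    intro ℓ hℓ x hx
    have hℓ' := Finset.mem_Icc.1 hℓ
    have := hle 1 ℓ le_rfl hℓ'.1 (by omega)
    linarith [Set.mem_Ioi.1 hx]
  have hiter := iteratedDeriv_sum_integral_div_add_sq (Finset.Icc 1 (n - 1)) isOpen_Ioi hw hmono hlow
    1 (1 / Real.pi) (fun ℓ => Real.sin (ℓ * Real.pi / n)) m t ht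
  have hcongr : Set.EqOn (iteratedDeriv m
      (deriv (fun t : ℝ => (∏ k ∈ Finset.Icc 1 n, (a k + t)) ^ ((n : ℝ)⁻¹)))) _ (Set.Ioi (-a 1)) :=
    Set.EqOn.iteratedDeriv_of_isOpen hderiv isOpen_Ioi m
  rw [hcongr ht, hiter, mul_add, mul_left_comm, ← mul_assoc ((-1 : ℝ) ^ m) ((-1) ^ m), ← mul_pow,
    neg_one_mul, neg_neg, one_pow, one_mul]
  refine add_nonneg ?_ (mul_nonneg (by positivity) (mul_nonneg (by positivity)
    (Finset.sum_nonneg fun ℓ hℓ => mul_nonneg (hsin ℓ hℓ) ?_)))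
  · rcases m with _ | m <;> simp
  · refine intervalIntegral.integral_nonneg (hmono ℓ hℓ) fun s hs => ?_
    have h1 := hlow ℓ hℓ t ht
    have h2 : 0 < s + t := by linarith [hs.1]
    exact div_nonneg (Real.rpow_nonneg (Finset.prod_nonneg fun _ _ => abs_nonneg _) _) (by positivity)
end

section
/- Let a_1, …, a_n be positive real numbers. Then the geometric mean G_n(a) = (∏_{k=1}^n a_k)^{1/n} satisfies G_n(a) = A_n(a) - (1/π) ∑_{ℓ=1}^{n-1} sin(ℓπ/n) ∫_{a_{[ℓ]}}^{a_{[ℓ+1]}} (∏_{k=1}^n |a_k - t|)^{1/n} dt/t, where a_{[1]} ≤ … ≤ a_{[n]} is the increasing rearrangement; in particular G_n(a) ≤ A_n(a). -/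
open Complex in
/-- Cauchy's theorem on a half annulus centred at the origin, in logarithmic coordinates. -/
theorem integral_boundary_half_annulus_eq_zero {F : ℂ → ℂ}
    (hc : ContinuousOn F {z | 0 ≤ z.im}) (hd : DifferentiableOn ℂ F {z | 0 < z.im}) (α β : ℝ) :
    (∫ x in α..β, F (Real.exp x)) - (∫ x in α..β, F (-Real.exp x))
      + I * (∫ y in (0 : ℝ)..Real.pi, F (Real.exp β * exp (y * I)))
      - I * (∫ y in (0 : ℝ)..Real.pi, F (Real.exp α * exp (y * I))) = 0 := by
  have him (z : ℂ) : (exp z).im = Real.exp z.re * Real.sin z.im := exp_im z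
  have h := integral_boundary_rect_eq_zero_of_continuousOn_of_differentiableOn
    (fun w => F (exp w)) (α : ℂ) (β + Real.pi * I) ?_ ?_
  · simpa [exp_add, exp_pi_mul_I] using h
  · refine hc.comp continuous_exp.continuousOn fun w hw => ?_
    have hw2 := hw.2
    simp only [Set.mem_preimage, ofReal_im, add_im, mul_im, ofReal_re, I_im, I_re, mul_one,
      mul_zero, add_zero, zero_add, Set.uIcc_of_le Real.pi_pos.le] at hw2
    rw [Set.mem_ofPred_eq, him]
    exact mul_nonneg (Real.exp_pos _).le (Real.sin_nonneg_of_mem_Icc hw2)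
  · refine hd.comp differentiable_exp.differentiableOn fun w hw => ?_
    have hw2 := hw.2
    simp only [Set.mem_preimage, ofReal_im, add_im, mul_im, ofReal_re, I_im, I_re, mul_one,
      mul_zero, add_zero, zero_add, min_eq_left Real.pi_pos.le, max_eq_right Real.pi_pos.le] at hw2
    rw [Set.mem_ofPred_eq, him]
    exact mul_pos (Real.exp_pos _) (Real.sin_pos_of_mem_Ioo hw2)

open Complex in
/-- The imaginary part of Cauchy's theorem on a half annulus, for a function that is real on the
negative half-line. -/
theorem integral_im_add_integral_re_half_annulus {F : ℂ → ℂ}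
    (hc : ContinuousOn F {z | 0 ≤ z.im}) (hd : DifferentiableOn ℂ F {z | 0 < z.im})
    (hreal : ∀ x : ℝ, 0 < x → (F (-x)).im = 0) (α β : ℝ) :
    (∫ x in α..β, (F (Real.exp x)).im)
      + (∫ y in (0 : ℝ)..Real.pi, F (Real.exp β * exp (y * I))).re
      - (∫ y in (0 : ℝ)..Real.pi, F (Real.exp α * exp (y * I))).re = 0 := by
  have h := congrArg Complex.im (integral_boundary_half_annulus_eq_zero hc hd α β)
  have h1 : (∫ x in α..β, (F (Real.exp x)).im) = (∫ x in α..β, F (Real.exp x)).im := by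
    refine imCLM.intervalIntegral_comp_comm (ContinuousOn.intervalIntegrable ?_)
    exact hc.comp (by fun_prop) fun x _ => by simp
  have h2 : (∫ x in α..β, F (-Real.exp x)).im = 0 := by
    have := imCLM.intervalIntegral_comp_comm (μ := MeasureTheory.volume)
      (f := fun x : ℝ => F (-Real.exp x)) (a := α) (b := β) (ContinuousOn.intervalIntegrable
        (hc.comp (by fun_prop) fun x _ => by simp))
    rw [imCLM_apply] at this
    rw [← this]
    simp [hreal _ (Real.exp_pos _), -ofReal_exp]
  rw [h1]
  simpa [-ofReal_exp, h2] using h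

open Complex in
theorem continuousOn_semicircle {F : ℂ → ℂ} (hc : ContinuousOn F {z | 0 ≤ z.im}) (r : ℝ)
    (hr : 0 ≤ r) : ContinuousOn (fun y : ℝ => F (r * exp (y * I))) (Set.uIcc 0 Real.pi) := by
  refine hc.comp (by fun_prop) fun y hy => ?_
  rw [Set.uIcc_of_le Real.pi_pos.le] at hy
  have := mul_nonneg hr (Real.sin_nonneg_of_mem_Icc hy)
  simpa [exp_ofReal_mul_I_im] using this

open Complex in
/-- If `F z` is close to `c + d z` on a half circle then the integral of the real part of `F` along
it is close to `π c`. -/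
theorem abs_re_integral_semicircle_sub_le {F : ℂ → ℂ} (hc : ContinuousOn F {z | 0 ≤ z.im})
    {r c d ε : ℝ} (hr : 0 ≤ r)
    (hF : ∀ z : ℂ, ‖z‖ = r → 0 ≤ z.im → ‖F z - (c + d * z)‖ ≤ ε) :
    |(∫ y in (0 : ℝ)..Real.pi, F (r * exp (y * I))).re - Real.pi * c| ≤ ε * Real.pi := by
  have hb : ‖∫ y in (0 : ℝ)..Real.pi, (F (r * exp (y * I)) - (c + d * (r * exp (y * I))))‖
      ≤ ε * |Real.pi - 0| := by
    refine intervalIntegral.norm_integral_le_of_norm_le_const fun y hy => hF _ ?_ ?_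
    · simp [norm_exp_ofReal_mul_I, abs_of_nonneg hr]
    · rw [Set.uIoc_of_le Real.pi_pos.le] at hy
      have := mul_nonneg hr (Real.sin_nonneg_of_mem_Icc ⟨hy.1.le, hy.2⟩)
      simpa [exp_ofReal_mul_I_im] using this
  have he : ∫ y in (0 : ℝ)..Real.pi, exp (y * I) = 2 * I := by
    have := integral_exp_mul_complex (a := 0) (b := Real.pi) I_ne_zero
    simp only [mul_comm I] at this
    rw [this]
    field_simp
    simp [exp_pi_mul_I]
    ring
  have hi : ∫ y in (0 : ℝ)..Real.pi, ((c : ℂ) + d * (r * exp (y * I)))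
      = Real.pi * c + d * (r * (2 * I)) := by
    rw [intervalIntegral.integral_add (by simp)
      (Continuous.intervalIntegrable (by fun_prop) _ _)]
    simp [he]
  rw [intervalIntegral.integral_sub (continuousOn_semicircle hc r hr).intervalIntegrable
    (Continuous.intervalIntegrable (by fun_prop) _ _), hi, sub_zero,
    abs_of_pos Real.pi_pos] at hb
  refine le_trans ?_ hb
  refine le_trans (le_of_eq ?_) (abs_re_le_norm _)
  simp

open Complex in
theorem mul_cpow_of_re_nonneg_of_re_pos {a b : ℂ} (ha : 0 ≤ a.re) (ha0 : a ≠ 0) (hb : 0 < b.re)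
    (r : ℂ) : (a * b) ^ r = a ^ r * b ^ r := by
  have hb0 : b ≠ 0 := by rintro rfl; simp at hb
  have h1 := abs_le.1 (abs_arg_le_pi_div_two_iff.2 ha)
  have h2 := abs_lt.1 (abs_arg_lt_pi_div_two_iff.2 (Or.inl hb))
  rw [cpow_def_of_ne_zero (mul_ne_zero ha0 hb0), cpow_def_of_ne_zero ha0, cpow_def_of_ne_zero hb0,
    log_mul ha0 hb0 ⟨by linarith, by linarith⟩, add_mul, exp_add]

open Complex in
/-- The branch of `∏ (b k - z) ^ (1 / n)`, positive at `-∞`, on the closed upper half-plane. -/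
noncomputable def geomMeanBranch (n : ℕ) (b : ℕ → ℝ) (z : ℂ) : ℂ :=
  -I * ∏ k ∈ Finset.Icc 1 n, (I * (b k - z)) ^ ((n : ℂ)⁻¹)

namespace geomMeanBranch

open Complex

variable {n : ℕ} {b : ℕ → ℝ}

theorem continuousOn (hn : 0 < n) : ContinuousOn (geomMeanBranch n b) {z | 0 ≤ z.im} := by
  refine ContinuousOn.mul continuousOn_const (continuousOn_finsetProd _ fun k _ z hz => ?_)
  refine ContinuousAt.continuousWithinAt ?_
  refine ContinuousAt.comp (f := fun z : ℂ => I * (b k - z)) (g := fun w : ℂ => w ^ ((n : ℂ)⁻¹))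
    (continuousAt_cpow_const_of_re_pos (Or.inl ?_) ?_) (by fun_prop)
  · simpa using hz
  · rw [← ofReal_natCast, ← ofReal_inv, ofReal_re]
    positivity

theorem differentiableOn : DifferentiableOn ℂ (geomMeanBranch n b) {z | 0 < z.im} := by
  intro z hz
  refine DifferentiableAt.differentiableWithinAt ?_
  refine DifferentiableAt.const_mul (DifferentiableAt.fun_finsetProd fun k _ => ?_) _
  refine DifferentiableAt.cpow_const (by fun_prop) (Or.inl ?_)
  simpa using hz

theorem cpow_of_nonneg {x : ℝ} (hx : 0 ≤ x) :
    (I * x) ^ ((n : ℂ)⁻¹) = ((|x| ^ ((n : ℝ)⁻¹) : ℝ) : ℂ) * exp (Real.pi / 2 * I * (n : ℂ)⁻¹) := by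
  rw [abs_of_nonneg hx, ofReal_cpow hx]
  push_cast
  rcases hx.eq_or_lt with rfl | hx
  · by_cases h : n = 0 <;> simp [h]
  have h0 : (x : ℂ) ≠ 0 := by exact_mod_cast hx.ne'
  rw [mul_cpow_of_re_nonneg_of_re_pos (by simp) I_ne_zero (by simpa using hx),
    cpow_def_of_ne_zero I_ne_zero, log_I, mul_comm]

theorem cpow_of_nonpos {x : ℝ} (hx : x ≤ 0) :
    (I * x) ^ ((n : ℂ)⁻¹) = ((|x| ^ ((n : ℝ)⁻¹) : ℝ) : ℂ) * exp (Real.pi / 2 * I * (n : ℂ)⁻¹)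
      * exp (-(Real.pi * I * (n : ℂ)⁻¹)) := by
  rw [abs_of_nonpos hx, ofReal_cpow (by linarith)]
  push_cast
  rcases hx.eq_or_lt with rfl | hx
  · by_cases h : n = 0 <;> simp [h]
  rw [show I * (x : ℂ) = -I * -x by ring,
    mul_cpow_of_re_nonneg_of_re_pos (by simp) (neg_ne_zero.2 I_ne_zero) (by simpa using hx),
    cpow_def_of_ne_zero (neg_ne_zero.2 I_ne_zero), log_neg_I, mul_comm,
    mul_assoc ((-(x : ℂ)) ^ _), ← exp_add]
  congr 2
  ring

theorem ofReal_eq (hn : 0 < n) {ℓ : ℕ} (hℓ : ℓ ≤ n) {t : ℝ}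
    (hle : ∀ k ∈ Finset.Icc 1 ℓ, b k ≤ t) (hge : ∀ k ∈ Finset.Icc (ℓ + 1) n, t ≤ b k) :
    geomMeanBranch n b t = (((∏ k ∈ Finset.Icc 1 n, |b k - t|) ^ ((n : ℝ)⁻¹) : ℝ) : ℂ)
      * exp (-((ℓ * Real.pi / n : ℝ) * I)) := by
  have hn0 : (n : ℂ) ≠ 0 := by exact_mod_cast hn.ne'
  have hfac : ∀ k ∈ Finset.Icc 1 n, (I * (b k - t)) ^ ((n : ℂ)⁻¹)
      = ((|b k - t| ^ ((n : ℝ)⁻¹) : ℝ) : ℂ) * exp (Real.pi / 2 * I * (n : ℂ)⁻¹)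
        * (if k ∈ Finset.Icc 1 ℓ then exp (-(Real.pi * I * (n : ℂ)⁻¹)) else 1) := by
    intro k hk
    rw [← ofReal_sub]
    split_ifs with h
    · exact cpow_of_nonpos (sub_nonpos.2 (hle k h))
    · rw [mul_one]
      refine cpow_of_nonneg (sub_nonneg.2 (hge k ?_))
      simp only [Finset.mem_Icc] at *
      omega
  have hsub : Finset.Icc 1 n ∩ Finset.Icc 1 ℓ = Finset.Icc 1 ℓ :=
    Finset.inter_eq_right.2 (Finset.Icc_subset_Icc_right hℓ)
  rw [geomMeanBranch, Finset.prod_congr rfl hfac, Finset.prod_mul_distrib, Finset.prod_mul_distrib,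
    Finset.prod_ite_mem, hsub, Finset.prod_const, Finset.prod_const, Nat.card_Icc, Nat.card_Icc,
    Nat.add_sub_cancel, Nat.add_sub_cancel, ← exp_nat_mul, ← exp_nat_mul,
    ← Real.finsetProd_rpow _ _ (fun _ _ => abs_nonneg _),
    show (n : ℂ) * (Real.pi / 2 * I * (n : ℂ)⁻¹) = Real.pi / 2 * I by field_simp, exp_pi_div_two_mul_I,
    show (ℓ : ℂ) * -(Real.pi * I * (n : ℂ)⁻¹) = -((ℓ * Real.pi / n : ℝ) * I) by
      push_cast; field_simp, ofReal_prod]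
  linear_combination (-(∏ k ∈ Finset.Icc 1 n, ((|b k - t| ^ ((n : ℝ)⁻¹) : ℝ) : ℂ))
    * exp (-((ℓ * Real.pi / n : ℝ) * I))) * I_mul_I

theorem im_ofReal (hn : 0 < n) {ℓ : ℕ} (hℓ : ℓ ≤ n) {t : ℝ}
    (hle : ∀ k ∈ Finset.Icc 1 ℓ, b k ≤ t) (hge : ∀ k ∈ Finset.Icc (ℓ + 1) n, t ≤ b k) :
    (geomMeanBranch n b t).im =
      -(Real.sin (ℓ * Real.pi / n) * (∏ k ∈ Finset.Icc 1 n, |b k - t|) ^ ((n : ℝ)⁻¹)) := by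
  rw [ofReal_eq hn hℓ hle hge, im_ofReal_mul, ← neg_mul, ← ofReal_neg, exp_ofReal_mul_I_im,
    Real.sin_neg]
  ring

theorem exists_norm_sub_le (hn : 0 < n) {ε : ℝ} (hε : 0 < ε) :
    ∃ R : ℝ, ∀ z : ℂ, R ≤ ‖z‖ → 0 ≤ z.im →
      ‖geomMeanBranch n b z - (((∑ k ∈ Finset.Icc 1 n, b k) / n : ℝ) - z)‖ ≤ ε := by
  have hn0 : (n : ℂ) ≠ 0 := by exact_mod_cast hn.ne'
  set A : ℂ := (((∑ k ∈ Finset.Icc 1 n, b k) / n : ℝ) : ℂ) with hA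
  let P : ℂ → ℂ := fun u => ∏ k ∈ Finset.Icc 1 n, (1 - b k * u) ^ ((n : ℂ)⁻¹)
  have hP0 : P 0 = 1 := by simp [P]
  have hP : HasDerivAt P (-A) 0 := by
    have := HasDerivAt.fun_finsetProd (u := Finset.Icc 1 n) (x := (0 : ℂ))
      (f := fun k u => (1 - (b k : ℂ) * u) ^ ((n : ℂ)⁻¹)) (f' := fun k => (n : ℂ)⁻¹ * -b k) ?_
    · refine this.congr_deriv ?_
      simp [hA, div_eq_inv_mul, Finset.mul_sum]
    · intro k _
      have h1 : HasDerivAt (fun u : ℂ => 1 - (b k : ℂ) * u) (-b k) 0 := by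
        simpa using ((hasDerivAt_id (0 : ℂ)).const_mul (b k : ℂ)).const_sub 1
      simpa using h1.cpow_const (c := (n : ℂ)⁻¹) (by simp)
  have hpos : ∀ᶠ u : ℂ in nhds 0, ∀ k ∈ Finset.Icc 1 n, 0 < (1 - b k * u).re := by
    rw [Filter.eventually_all_finset]
    intro k _
    exact ContinuousAt.eventually_lt (f := fun _ : ℂ => (0 : ℝ))
      (g := fun u : ℂ => (1 - b k * u).re) continuousAt_const (by fun_prop) (by simp)
  have hsmall := hpos.and ((hasDerivAt_iff_isLittleO.1 hP).def hε)
  obtain ⟨δ, hδ, hball⟩ := Metric.eventually_nhds_iff.1 hsmall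
  refine ⟨δ⁻¹ + 1, fun z hz him => ?_⟩
  have hδ' : 0 < δ⁻¹ := inv_pos.2 hδ
  have hz0 : z ≠ 0 := norm_pos_iff.1 (by linarith)
  obtain ⟨hre, hder⟩ := hball (y := z⁻¹) (by
    rw [dist_zero_right, norm_inv]
    exact inv_lt_of_inv_lt₀ hδ (by linarith))
  have hbranch : geomMeanBranch n b z = -z * P z⁻¹ := by
    have hfac : ∀ k ∈ Finset.Icc 1 n, (I * (b k - z)) ^ ((n : ℂ)⁻¹)
        = (-I * z) ^ ((n : ℂ)⁻¹) * (1 - b k * z⁻¹) ^ ((n : ℂ)⁻¹) := by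
      intro k hk
      rw [← mul_cpow_of_re_nonneg_of_re_pos (by simpa using him) (by simp [hz0]) (hre k hk)]
      congr 1
      field_simp
      ring
    rw [geomMeanBranch, Finset.prod_congr rfl hfac, Finset.prod_mul_distrib, Finset.prod_const,
      Nat.card_Icc, Nat.add_sub_cancel, cpow_nat_inv_pow _ hn.ne']
    linear_combination (z * P z⁻¹) * I_mul_I
  rw [hP0, sub_zero, norm_inv] at hder
  have hmul : geomMeanBranch n b z - (A - z) = -z * (P z⁻¹ - 1 - z⁻¹ • -A) := by
    rw [hbranch, smul_eq_mul]
    field_simp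
    ring
  rw [hmul, norm_mul, norm_neg]
  calc ‖z‖ * ‖P z⁻¹ - 1 - z⁻¹ • -A‖ ≤ ‖z‖ * (ε * ‖z‖⁻¹) := by gcongr
    _ = ε := by field_simp [norm_ne_zero_iff.2 hz0]

theorem integral_im_exp (hn : 0 < n) (hpos : ∀ k ∈ Finset.Icc 1 n, 0 < b k)
    (hmono : ∀ i j, 1 ≤ i → i ≤ j → j ≤ n → b i ≤ b j) {r R : ℝ} (hr : 0 < r) (hr1 : r ≤ b 1)
    (hR : b n ≤ R) :
    ∫ x in Real.log r..Real.log R, (geomMeanBranch n b (Real.exp x)).im =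
      -∑ ℓ ∈ Finset.Icc 1 (n - 1), Real.sin (ℓ * Real.pi / n) *
        ∫ t in (b ℓ)..(b (ℓ + 1)), (∏ k ∈ Finset.Icc 1 n, |b k - t|) ^ ((n : ℝ)⁻¹) / t := by
  have hbpos : ∀ k, 1 ≤ k → k ≤ n → 0 < b k := fun k h1 h2 => hpos k (Finset.mem_Icc.2 ⟨h1, h2⟩)
  have hRpos : 0 < R := (hbpos n hn le_rfl).trans_le hR
  let q : ℝ → ℝ := fun t => (geomMeanBranch n b t).im / t
  have hq : ContinuousOn q (Set.Ioi 0) := by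
    refine ContinuousOn.div (continuous_im.comp_continuousOn ((continuousOn hn).comp
      continuous_ofReal.continuousOn fun x _ => by simp)) continuousOn_id fun x hx => ne_of_gt hx
  have hint : ∀ x y : ℝ, 0 < x → 0 < y → IntervalIntegrable q MeasureTheory.volume x y :=
    fun x y hx hy => (hq.mono fun t ht => (lt_min hx hy).trans_le ht.1).intervalIntegrable
  have hqeq : ∀ ℓ ≤ n, ∀ t, (∀ k ∈ Finset.Icc 1 ℓ, b k ≤ t) →
      (∀ k ∈ Finset.Icc (ℓ + 1) n, t ≤ b k) → q t = -(Real.sin (ℓ * Real.pi / n) *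
        ((∏ k ∈ Finset.Icc 1 n, |b k - t|) ^ ((n : ℝ)⁻¹) / t)) := by
    intro ℓ hℓ t h1 h2
    simp only [q]
    rw [im_ofReal hn hℓ h1 h2]
    ring
  have hchange : ∫ x in Real.log r..Real.log R, (geomMeanBranch n b (Real.exp x)).im
      = ∫ t in r..R, q t := by
    have := intervalIntegral.integral_comp_mul_deriv' (a := Real.log r) (b := Real.log R)
      (f := Real.exp) (f' := Real.exp) (g := q) (fun x _ => Real.hasDerivAt_exp x)
      Real.continuous_exp.continuousOn (hq.mono ?_)
    · rw [Real.exp_log hr, Real.exp_log hRpos] at this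
      rw [← this]
      refine intervalIntegral.integral_congr fun x _ => ?_
      simp only [q, Function.comp]
      rw [div_mul_cancel₀ _ (Real.exp_ne_zero x)]
    · rintro _ ⟨x, _, rfl⟩
      exact Real.exp_pos x
  have hleft : ∫ t in r..b 1, q t = 0 := by
    refine (intervalIntegral.integral_congr (g := fun _ => (0 : ℝ)) fun t ht => ?_).trans (by simp)
    rw [Set.uIcc_of_le hr1] at ht
    simp only
    rw [hqeq 0 (Nat.zero_le n) t (by simp) fun k hk => ?_]
    · simp
    · rw [Finset.mem_Icc] at hk
      exact ht.2.trans (hmono 1 k le_rfl hk.1 hk.2)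
  have hright : ∫ t in b n..R, q t = 0 := by
    refine (intervalIntegral.integral_congr (g := fun _ => (0 : ℝ)) fun t ht => ?_).trans (by simp)
    rw [Set.uIcc_of_le hR] at ht
    simp only
    rw [hqeq n le_rfl t (fun k hk => ?_) (by simp), mul_div_cancel_left₀ _ (by positivity)]
    · simp
    · rw [Finset.mem_Icc] at hk
      exact (hmono k n hk.1 hk.2 le_rfl).trans ht.1
  have hmid : ∑ ℓ ∈ Finset.Ico 1 n, ∫ t in b ℓ..b (ℓ + 1), q t = ∫ t in b 1..b n, q t :=
    intervalIntegral.sum_integral_adjacent_intervals_Ico hn fun k hk =>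
      hint _ _ (hbpos k hk.1 hk.2.le) (hbpos (k + 1) (by omega) hk.2)
  have hIcc : Finset.Icc 1 (n - 1) = Finset.Ico 1 n := by
    ext k
    simp only [Finset.mem_Icc, Finset.mem_Ico]
    omega
  rw [hchange, ← intervalIntegral.integral_add_adjacent_intervals
    (hint r (b 1) hr (hbpos 1 le_rfl hn)) (hint (b 1) R (hbpos 1 le_rfl hn) hRpos),
    ← intervalIntegral.integral_add_adjacent_intervals
    (hint (b 1) (b n) (hbpos 1 le_rfl hn) (hbpos n hn le_rfl)) (hint (b n) R (hbpos n hn le_rfl)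
    hRpos), hleft, hright, ← hmid, zero_add, add_zero, hIcc, ← Finset.sum_neg_distrib]
  refine Finset.sum_congr rfl fun ℓ hℓ => ?_
  rw [Finset.mem_Ico] at hℓ
  rw [← intervalIntegral.integral_const_mul, ← intervalIntegral.integral_neg]
  refine intervalIntegral.integral_congr fun t ht => ?_
  rw [Set.uIcc_of_le (hmono ℓ (ℓ + 1) hℓ.1 (Nat.le_succ ℓ) hℓ.2)] at ht
  refine hqeq ℓ hℓ.2.le t (fun k hk => ?_) fun k hk => ?_
  · rw [Finset.mem_Icc] at hk
    exact (hmono k ℓ hk.1 hk.2 hℓ.2.le).trans ht.1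
  · rw [Finset.mem_Icc] at hk
    exact ht.2.trans (hmono (ℓ + 1) k (by omega) hk.1 hk.2)

end geomMeanBranch

/-- The integral representation of the geometric mean of an increasing sequence. -/
theorem geom_mean_eq_arith_mean_sub_of_monotone {n : ℕ} {b : ℕ → ℝ} (hn : 0 < n)
    (hpos : ∀ k ∈ Finset.Icc 1 n, 0 < b k)
    (hmono : ∀ i j, 1 ≤ i → i ≤ j → j ≤ n → b i ≤ b j) :
    (∏ k ∈ Finset.Icc 1 n, b k) ^ ((n : ℝ)⁻¹)
      = (∑ k ∈ Finset.Icc 1 n, b k) / n -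
        (1 / Real.pi) * ∑ ℓ ∈ Finset.Icc 1 (n - 1), Real.sin (ℓ * Real.pi / n) *
          ∫ t in (b ℓ)..(b (ℓ + 1)), (∏ k ∈ Finset.Icc 1 n, |b k - t|) ^ ((n : ℝ)⁻¹) / t := by
  set S := ∑ ℓ ∈ Finset.Icc 1 (n - 1), Real.sin (ℓ * Real.pi / n) *
    ∫ t in (b ℓ)..(b (ℓ + 1)), (∏ k ∈ Finset.Icc 1 n, |b k - t|) ^ ((n : ℝ)⁻¹) / t with hS
  set A := (∑ k ∈ Finset.Icc 1 n, b k) / n with hA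
  set G := (∏ k ∈ Finset.Icc 1 n, b k) ^ ((n : ℝ)⁻¹) with hG
  have hc := geomMeanBranch.continuousOn (b := b) hn
  have hb1 : 0 < b 1 := hpos 1 (Finset.mem_Icc.2 ⟨le_rfl, hn⟩)
  have hneg : ∀ x : ℝ, 0 < x → (geomMeanBranch n b (-x)).im = 0 := by
    intro x hx
    rw [← Complex.ofReal_neg, geomMeanBranch.im_ofReal hn (Nat.zero_le n) (by simp)
      fun k hk => ?_]
    · simp
    · have := hpos k (by simpa using hk)
      linarith
  have hzero : geomMeanBranch n b 0 = G := by
    have := geomMeanBranch.ofReal_eq (b := b) (t := 0) hn (Nat.zero_le n) (by simp)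
      fun k hk => (hpos k (by simpa using hk)).le
    rw [Complex.ofReal_zero] at this
    rw [this, hG, Finset.prod_congr rfl fun k hk => by rw [sub_zero, abs_of_pos (hpos k hk)]]
    simp
  have key : ∀ ε > 0, dist (Real.pi * G) (Real.pi * A - S) ≤ 2 * Real.pi * ε := by
    intro ε hε
    obtain ⟨R, hR⟩ := geomMeanBranch.exists_norm_sub_le (b := b) hn hε
    obtain ⟨δ, hδ, hnear⟩ := Metric.continuousWithinAt_iff.1 (hc 0 (by simp)) ε hε
    set R' := max R (b n) with hR'
    have hR'pos : 0 < R' := (hpos n (Finset.mem_Icc.2 ⟨hn, le_rfl⟩)).trans_le (le_max_right _ _)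
    set r := min (δ / 2) (b 1) with hr'
    have hr : 0 < r := lt_min (by linarith) hb1
    have hfar := abs_re_integral_semicircle_sub_le (F := geomMeanBranch n b) (r := R') (c := A)
      (d := -1) (ε := ε) hc hR'pos.le fun z hz him => by
        have := hR z (hz ▸ le_max_left _ _) him
        simpa [hA, sub_eq_add_neg] using this
    have hclose := abs_re_integral_semicircle_sub_le (F := geomMeanBranch n b) (r := r) (c := G)
      (d := 0) (ε := ε) hc hr.le fun z hz him => by
        have := hnear (x := z) him (by
          rw [dist_zero_right, hz]
          exact (min_le_left _ _).trans_lt (by linarith))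
        rw [hzero, dist_eq_norm] at this
        simpa using this.le
    have hcauchy := integral_im_add_integral_re_half_annulus hc geomMeanBranch.differentiableOn hneg
      (Real.log r) (Real.log R')
    rw [geomMeanBranch.integral_im_exp hn hpos hmono hr (min_le_right _ _) (le_max_right _ _),
      Real.exp_log hr, Real.exp_log hR'pos, ← hS] at hcauchy
    rw [Real.dist_eq]
    rw [abs_le] at *
    constructor <;> linarith
  have heq : Real.pi * G = Real.pi * A - S := by
    refine eq_of_forall_dist_le fun ε hε => ?_
    have := key (ε / (2 * Real.pi)) (by positivity)
    rwa [mul_div_cancel₀ _ (by positivity)] at this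
  field_simp
  linarith

/-- Integral representation of the geometric mean of positive reals `a_1, …, a_n`, where
`σ` realizes the increasing rearrangement of `a` on `{1, …, n}`; in particular the
AG inequality `G_n(a) ≤ A_n(a)` follows. -/
theorem geometric_mean_integral_representation_real (n : ℕ) (hn : 0 < n) (a : ℕ → ℝ)
    (hpos : ∀ k ∈ Finset.Icc 1 n, 0 < a k)
    (σ : Equiv.Perm ℕ) (hσ : ∀ k ∈ Finset.Icc 1 n, σ k ∈ Finset.Icc 1 n)
    (hsort : ∀ k ∈ Finset.Icc 1 (n - 1), a (σ k) ≤ a (σ (k + 1))) :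
    (∏ k ∈ Finset.Icc 1 n, a k) ^ ((n : ℝ)⁻¹)
      = (∑ k ∈ Finset.Icc 1 n, a k) / n -
        (1 / Real.pi) * ∑ ℓ ∈ Finset.Icc 1 (n - 1),
          Real.sin (ℓ * Real.pi / n) *
            ∫ t in (a (σ ℓ))..(a (σ (ℓ + 1))),
              (∏ k ∈ Finset.Icc 1 n, |a k - t|) ^ ((n : ℝ)⁻¹) / t ∧
    (∏ k ∈ Finset.Icc 1 n, a k) ^ ((n : ℝ)⁻¹) ≤ (∑ k ∈ Finset.Icc 1 n, a k) / n := by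
  have himage : (Finset.Icc 1 n).image σ = Finset.Icc 1 n :=
    Finset.eq_of_subset_of_card_le (Finset.image_subset_iff.2 hσ)
      (Finset.card_image_of_injective _ σ.injective).ge
  have hprod (f : ℕ → ℝ) : ∏ k ∈ Finset.Icc 1 n, f (σ k) = ∏ k ∈ Finset.Icc 1 n, f k := by
    conv_rhs => rw [← himage, Finset.prod_image σ.injective.injOn]
  have hsum : ∑ k ∈ Finset.Icc 1 n, a (σ k) = ∑ k ∈ Finset.Icc 1 n, a k := by
    conv_rhs => rw [← himage, Finset.sum_image σ.injective.injOn]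
  refine ⟨?_, ?_⟩
  · have hmono : ∀ i j, 1 ≤ i → i ≤ j → j ≤ n → a (σ i) ≤ a (σ j) := by
      intro i j hi hij
      induction j, hij using Nat.le_induction with
      | base => exact fun _ => le_rfl
      | succ j hij ih =>
        exact fun hj => (ih (by omega)).trans (hsort j (Finset.mem_Icc.2 ⟨by omega, by omega⟩))
    have h := geom_mean_eq_arith_mean_sub_of_monotone (b := fun k => a (σ k)) hn
      (fun k hk => hpos _ (hσ k hk)) hmono
    simp only [hprod a, hsum, fun t : ℝ => hprod fun k => |a k - t|] at h
    exact h
  · have h := Real.geom_mean_le_arith_mean (Finset.Icc 1 n) (fun _ => 1) a (by simp)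
      (by simpa using hn) (fun k hk => (hpos k hk).le)
    simpa using h
end

section
/- For positive reals x > y > 0 and t > -y, the shifted geometric mean admits the representation sqrt((x+t)(y+t)) = sqrt(xy) + t + ((x-y)/(2π)) ∫_0^∞ (ρ((x-y)s)/s) e^{-ys} (1 - e^{-st}) ds, where ρ(s) = ∫_0^{1/2} q(u)(1 - e^{-(1-2u)s}) e^{-us} du and q(u) = sqrt(1/u - 1) - 1/sqrt(1/u - 1). -/
open MeasureTheory Filter Topology in
lemma tendsto_sqrt_div_one_sub_atTop :
    Tendsto (fun v : ℝ => √(v / (1 - v))) (𝓝[<] 1) atTop := by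
  refine Real.tendsto_sqrt_atTop.comp ?_
  have h₁ : Tendsto (fun v : ℝ => 1 - v) (𝓝[<] 1) (𝓝[>] 0) := by
    refine tendsto_nhdsWithin_iff.2 ⟨?_, ?_⟩
    · have h : ContinuousAt (fun v : ℝ => 1 - v) 1 := by fun_prop
      simpa [ContinuousAt] using h.tendsto.mono_left nhdsWithin_le_nhds
    · filter_upwards [self_mem_nhdsWithin] with v hv
      simpa using hv
  have h₂ : Tendsto (fun v : ℝ => v) (𝓝[<] 1) (𝓝 1) := nhdsWithin_le_nhds
  simpa [div_eq_mul_inv] using h₂.pos_mul_atTop one_pos (tendsto_inv_nhdsGT_zero.comp h₁)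

lemma hasDerivAt_sqrt_mul_one_sub {v : ℝ} (h₀ : 0 < v) (h₁ : v < 1) :
    HasDerivAt (fun v : ℝ => √(v * (1 - v))) ((1 - 2 * v) / (2 * √(v * (1 - v)))) v := by
  have h : HasDerivAt (fun v : ℝ => v * (1 - v)) (1 - 2 * v) v :=
    ((hasDerivAt_id' v).mul ((hasDerivAt_id' v).const_sub 1)).congr_deriv (by ring)
  exact h.sqrt (mul_pos h₀ (sub_pos.2 h₁)).ne'

lemma hasDerivAt_arctan_mul_sqrt_div (k : ℝ) {v : ℝ} (h₀ : 0 < v) (h₁ : v < 1) :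
    HasDerivAt (fun v : ℝ => Real.arctan (k * √(v / (1 - v))))
      (k / (2 * √(v * (1 - v)) * (1 - v + k ^ 2 * v))) v := by
  have h₂ : 0 < 1 - v := sub_pos.2 h₁
  have h₃ : HasDerivAt (fun v : ℝ => v / (1 - v)) (1 / (1 - v) ^ 2) v :=
    ((hasDerivAt_id' v).div ((hasDerivAt_id' v).const_sub 1) h₂.ne').congr_deriv (by ring)
  have h₄ := ((h₃.sqrt (div_pos h₀ h₂).ne').const_mul k).arctan
  refine h₄.congr_deriv ?_
  have h₅ : √(v * (1 - v)) = √(v / (1 - v)) * (1 - v) := by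
    rw [show v * (1 - v) = v / (1 - v) * (1 - v) ^ 2 by field_simp,
      Real.sqrt_mul (div_pos h₀ h₂).le, Real.sqrt_sq h₂.le]
  have h₆ : 0 < √(v / (1 - v)) := Real.sqrt_pos.2 (div_pos h₀ h₂)
  have h₇ : 0 < 1 - v + k ^ 2 * v := by positivity
  rw [h₅, mul_pow, Real.sq_sqrt (div_pos h₀ h₂).le]
  have h₈ : 1 + k ^ 2 * (v / (1 - v)) = (1 - v + k ^ 2 * v) / (1 - v) := by field_simp
  rw [h₈]
  field_simp

open Filter Topology in
lemma integral_sqrt_mul_one_sub_div_add {c : ℝ} (hc : 0 < c) :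
    ∫ v in (0 : ℝ)..1, √(v * (1 - v)) / (c + v) = Real.pi * (c + 1 / 2 - √(c * (c + 1))) := by
  set k : ℝ := √((c + 1) / c) with hk
  have hk₀ : 0 < k := by positivity
  have hk₂ : k ^ 2 = (c + 1) / c := Real.sq_sqrt (by positivity)
  have hck : √(c * (c + 1)) = c * k := by
    rw [hk, ← Real.sqrt_sq hc.le, ← Real.sqrt_mul (by positivity), Real.sqrt_sq hc.le]
    congr 1
    field_simp
  have hcont (m : ℝ) : ContinuousAt (fun v : ℝ => Real.arctan (m * √(v / (1 - v)))) 0 := by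
    have h : ContinuousAt (fun v : ℝ => v / (1 - v)) 0 :=
      continuousAt_id.div (by fun_prop) (by norm_num)
    exact Real.continuous_arctan.continuousAt.comp (h.sqrt.const_mul m)
  have hlim {m : ℝ} (hm : 0 < m) :
      Tendsto (fun v : ℝ => Real.arctan (m * √(v / (1 - v)))) (𝓝[<] 1) (𝓝 (Real.pi / 2)) :=
    (Real.tendsto_arctan_atTop.mono_right nhdsWithin_le_nhds).comp
      (tendsto_sqrt_div_one_sub_atTop.const_mul_atTop hm)
  have hroot : Continuous (fun v : ℝ => √(v * (1 - v))) := by fun_prop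
  rw [intervalIntegral.integral_eq_sub_of_hasDerivAt_of_tendsto
    (f := fun v => √(v * (1 - v)) + (2 * c + 1) * Real.arctan (1 * √(v / (1 - v)))
      - 2 * (c * k) * Real.arctan (k * √(v / (1 - v))))
    (fa := 0) (fb := 0 + (2 * c + 1) * (Real.pi / 2) - 2 * (c * k) * (Real.pi / 2)) one_pos]
  · rw [hck]
    ring
  · rintro v ⟨h₀, h₁⟩
    refine (((hasDerivAt_sqrt_mul_one_sub h₀ h₁).add
      ((hasDerivAt_arctan_mul_sqrt_div 1 h₀ h₁).const_mul _)).sub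
      ((hasDerivAt_arctan_mul_sqrt_div k h₀ h₁).const_mul _)).congr_deriv ?_
    have hr : 0 < √(v * (1 - v)) := Real.sqrt_pos.2 (mul_pos h₀ (sub_pos.2 h₁))
    have hr₂ : √(v * (1 - v)) ^ 2 = v * (1 - v) :=
      Real.sq_sqrt (mul_pos h₀ (sub_pos.2 h₁)).le
    have hd : 1 - v + k ^ 2 * v = (c + v) / c := by
      rw [hk₂]
      field_simp
      ring
    rw [hd]
    have hcv : 0 < c + v := by positivity
    rw [show 1 - v + 1 ^ 2 * v = 1 by ring]
    field_simp
    rw [hr₂, hk₂]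
    field_simp
    ring
  · refine ContinuousOn.intervalIntegrable ?_
    refine hroot.continuousOn.div (by fun_prop) fun v hv => ?_
    rw [Set.uIcc_of_le zero_le_one] at hv
    linarith [hv.1]
  · have h := ((hroot.continuousAt (x := 0)).add ((hcont 1).const_mul (2 * c + 1))).sub
      ((hcont k).const_mul (2 * (c * k)))
    simpa [Pi.add_def, Pi.sub_def] using
      h.tendsto.mono_left (nhdsWithin_le_nhds (s := Set.Ioi 0))
  · have h : Tendsto (fun v : ℝ => √(v * (1 - v))) (𝓝[<] 1) (𝓝 0) := by
      simpa using (hroot.tendsto 1).mono_left (nhdsWithin_le_nhds (s := Set.Iio 1))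
    exact (h.add ((hlim one_pos).const_mul _)).sub ((hlim hk₀).const_mul _)

lemma integral_sqrt_mul_one_sub_div_add_mul {b d : ℝ} (hb : 0 < b) (hd : 0 < d) :
    ∫ v in (0 : ℝ)..1, √(v * (1 - v)) / (b + v * d)
      = Real.pi / d ^ 2 * (b + d / 2 - √(b * (b + d))) := by
  have h : ∀ v : ℝ, √(v * (1 - v)) / (b + v * d) = d⁻¹ * (√(v * (1 - v)) / (b / d + v)) := by
    intro v
    rw [show b + v * d = d * (b / d + v) by field_simp, ← div_div, inv_mul_eq_div, div_right_comm]
  have h₁ : √(b / d * (b / d + 1)) = √(b * (b + d)) / d := by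
    rw [← Real.sqrt_sq hd.le, ← Real.sqrt_div (by positivity), Real.sqrt_sq hd.le]
    congr 1
    field_simp
  simp_rw [h]
  rw [intervalIntegral.integral_const_mul, integral_sqrt_mul_one_sub_div_add (by positivity), h₁]
  field_simp

open MeasureTheory in
lemma integrable_sqrt_mul_one_sub_mul_exp {b d : ℝ} (hb : 0 < b) (hd : 0 < d) :
    Integrable (Function.uncurry fun v s : ℝ => √(v * (1 - v)) * Real.exp (-(b + v * d) * s))
      ((volume.restrict (Set.uIoc 0 1)).prod (volume.restrict (Set.Ioi 0))) := by
  have h₁ : Integrable (fun v : ℝ => √(v * (1 - v))) (volume.restrict (Set.uIoc 0 1)) := by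
    rw [Set.uIoc_of_le zero_le_one]
    exact (Continuous.intervalIntegrable (by fun_prop) 0 1).1
  have h₂ : Integrable (fun s : ℝ => Real.exp (-b * s)) (volume.restrict (Set.Ioi 0)) :=
    exp_neg_integrableOn_Ioi 0 hb
  have h₃ := (h₁.mul_prod h₂).bdd_mul (c := 1) (f := fun z : ℝ × ℝ => Real.exp (-(z.1 * d * z.2)))
    (Continuous.aestronglyMeasurable (by fun_prop)) (by
      rw [Measure.prod_restrict]
      filter_upwards [ae_restrict_mem (measurableSet_uIoc.prod measurableSet_Ioi)] with z hz
      rw [Set.uIoc_of_le zero_le_one] at hz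
      have h₀ : 0 < z.1 := hz.1.1
      have h₄ : 0 < z.2 := hz.2
      rw [Real.norm_eq_abs, Real.abs_exp, Real.exp_le_one_iff, neg_nonpos]
      positivity)
  refine h₃.congr (Filter.Eventually.of_forall fun z => ?_)
  simp only [Function.uncurry]
  rw [mul_left_comm, ← Real.exp_add]
  ring_nf

open MeasureTheory in
lemma integrableOn_integral_sqrt_mul_one_sub_mul_exp {b d : ℝ} (hb : 0 < b) (hd : 0 < d) :
    IntegrableOn (fun s : ℝ => ∫ v in (0 : ℝ)..1, √(v * (1 - v)) * Real.exp (-(b + v * d) * s))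
      (Set.Ioi 0) := by
  have h := (integrable_sqrt_mul_one_sub_mul_exp hb hd).integral_prod_right
  simpa only [IntegrableOn, Function.uncurry, Set.uIoc_of_le zero_le_one,
    ← intervalIntegral.integral_of_le zero_le_one] using h

open MeasureTheory in
lemma integral_integral_sqrt_mul_one_sub_mul_exp {b d : ℝ} (hb : 0 < b) (hd : 0 < d) :
    ∫ s in Set.Ioi (0 : ℝ), ∫ v in (0 : ℝ)..1, √(v * (1 - v)) * Real.exp (-(b + v * d) * s)
      = Real.pi / d ^ 2 * (b + d / 2 - √(b * (b + d))) := by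
  rw [← intervalIntegral_integral_swap (integrable_sqrt_mul_one_sub_mul_exp hb hd),
    ← integral_sqrt_mul_one_sub_div_add_mul hb hd]
  refine intervalIntegral.integral_congr fun v hv => ?_
  rw [Set.uIcc_of_le zero_le_one] at hv
  have hbv : 0 < b + v * d := by have := mul_nonneg hv.1 hd.le; positivity
  rw [integral_const_mul, integral_exp_mul_Ioi (by linarith)]
  rw [mul_zero, Real.exp_zero, neg_div_neg_eq, mul_one_div]

lemma sqrt_one_div_sub_one_sub_one_div {u : ℝ} (h₀ : 0 < u) (h₁ : u < 1) :
    √(1 / u - 1) - 1 / √(1 / u - 1) = 2 * ((1 - 2 * u) / (2 * √(u * (1 - u)))) := by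
  have h₂ : 0 < 1 - u := sub_pos.2 h₁
  have hw : 0 < 1 / u - 1 := by
    rw [show 1 / u - 1 = (1 - u) / u by field_simp]
    positivity
  have hs : √(u * (1 - u)) = u * √(1 / u - 1) := by
    rw [← Real.sqrt_sq h₀.le, ← Real.sqrt_mul (by positivity), Real.sqrt_sq h₀.le]
    congr 1
    field_simp
  have hs₀ := Real.sqrt_pos.2 hw
  have hs₂ : √(1 / u - 1) ^ 2 = 1 / u - 1 := Real.sq_sqrt hw.le
  rw [hs]
  generalize √(1 / u - 1) = w at *
  field_simp
  rw [hs₂]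
  field_simp
  ring

open MeasureTheory in
lemma integral_sqrt_sub_inv_sqrt_mul_exp (r : ℝ) :
    ∫ u in (0 : ℝ)..(1 / 2), (√(1 / u - 1) - 1 / √(1 / u - 1)) *
        (1 - Real.exp (-(1 - 2 * u) * r)) * Real.exp (-u * r)
      = 2 * r * ∫ v in (0 : ℝ)..1, √(v * (1 - v)) * Real.exp (-v * r) := by
  have hhalf : (0 : ℝ) ≤ 1 / 2 := by norm_num
  have hroot : Continuous (fun v : ℝ => √(v * (1 - v))) := by fun_prop
  have hderiv : ∀ u ∈ Set.Ioo (min (0 : ℝ) (1 / 2)) (max 0 (1 / 2)),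
      HasDerivAt (fun v : ℝ => √(v * (1 - v))) ((1 - 2 * u) / (2 * √(u * (1 - u)))) u := by
    rw [min_eq_left hhalf, max_eq_right hhalf]
    exact fun u hu => hasDerivAt_sqrt_mul_one_sub hu.1 (by linarith [hu.2])
  have hint : IntervalIntegrable (fun u : ℝ => (1 - 2 * u) / (2 * √(u * (1 - u)))) volume
      0 (1 / 2) := by
    refine intervalIntegral.intervalIntegrable_deriv_of_nonneg hroot.continuousOn hderiv ?_
    rw [min_eq_left hhalf, max_eq_right hhalf]
    intro u hu
    exact div_nonneg (by linarith [hu.2]) (by positivity)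
  have hexp (u : ℝ) : HasDerivAt (fun u : ℝ => Real.exp (-u * r) - Real.exp (-(1 - u) * r))
      (-r * (Real.exp (-u * r) + Real.exp (-(1 - u) * r))) u := by
    have h₁ : HasDerivAt (fun u : ℝ => -u * r) (-r) u :=
      ((hasDerivAt_id' u).neg.mul_const r).congr_deriv (by ring)
    have h₂ : HasDerivAt (fun u : ℝ => -(1 - u) * r) r u :=
      (((hasDerivAt_id' u).const_sub 1).neg.mul_const r).congr_deriv (by ring)
    exact (h₁.exp.sub h₂.exp).congr_deriv (by ring)
  have hparts := intervalIntegral.integral_mul_deriv_eq_deriv_mul_of_hasDerivAt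
    (u := fun u : ℝ => Real.exp (-u * r) - Real.exp (-(1 - u) * r))
    (v := fun v : ℝ => √(v * (1 - v)))
    (by fun_prop) hroot.continuousOn (fun u _ => hexp u) hderiv
    (Continuous.intervalIntegrable (by fun_prop) _ _) hint
  have hleft : ∫ u in (0 : ℝ)..(1 / 2), (√(1 / u - 1) - 1 / √(1 / u - 1)) *
        (1 - Real.exp (-(1 - 2 * u) * r)) * Real.exp (-u * r)
      = 2 * ∫ u in (0 : ℝ)..(1 / 2), (Real.exp (-u * r) - Real.exp (-(1 - u) * r)) *
          ((1 - 2 * u) / (2 * √(u * (1 - u)))) := by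
    rw [← intervalIntegral.integral_const_mul]
    refine intervalIntegral.integral_congr_ae (Filter.Eventually.of_forall fun u hu => ?_)
    rw [Set.uIoc_of_le hhalf] at hu
    rw [sqrt_one_div_sub_one_sub_one_div hu.1 (by linarith [hu.2]),
      show -(1 - u) * r = -(1 - 2 * u) * r + -u * r by ring, Real.exp_add]
    ring
  have hsym : ∫ u in (0 : ℝ)..(1 / 2), √(u * (1 - u)) * Real.exp (-(1 - u) * r)
      = ∫ v in (1 / 2 : ℝ)..1, √(v * (1 - v)) * Real.exp (-v * r) := by
    have h := intervalIntegral.integral_comp_sub_left (a := 0) (b := 1 / 2)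
      (fun v : ℝ => √(v * (1 - v)) * Real.exp (-v * r)) 1
    norm_num at h
    norm_num
    rw [← h]
    refine intervalIntegral.integral_congr fun u _ => ?_
    rw [mul_comm u]
  have hsplit : ∫ v in (0 : ℝ)..1, √(v * (1 - v)) * Real.exp (-v * r)
      = ∫ u in (0 : ℝ)..(1 / 2),
          √(u * (1 - u)) * Real.exp (-u * r) + √(u * (1 - u)) * Real.exp (-(1 - u) * r) := by
    rw [intervalIntegral.integral_add (Continuous.intervalIntegrable (by fun_prop) _ _)
      (Continuous.intervalIntegrable (by fun_prop) _ _), hsym,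
      intervalIntegral.integral_add_adjacent_intervals
      (Continuous.intervalIntegrable (by fun_prop) _ _)
      (Continuous.intervalIntegrable (by fun_prop) _ _)]
  rw [hleft, hparts, hsplit, ← intervalIntegral.integral_const_mul]
  rw [show (-(1 - 1 / 2) : ℝ) = -(1 / 2) by norm_num]
  simp only [sub_self, zero_mul, Real.sqrt_zero, mul_zero, zero_sub]
  rw [← intervalIntegral.integral_neg, ← intervalIntegral.integral_const_mul]
  refine intervalIntegral.integral_congr fun u _ => ?_
  ring


/-- Lévy–Khintchine-type representation of the shifted geometric mean of two variables:
for `x > y > 0` and `t > -y`,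
`sqrt((x+t)(y+t)) = sqrt(xy) + t + ((x-y)/(2π)) ∫_0^∞ (ρ((x-y)s)/s) e^{-ys}(1-e^{-st}) ds`,
where `ρ(s) = ∫_0^{1/2} q(u)(1-e^{-(1-2u)s}) e^{-us} du` and
`q(u) = sqrt(1/u-1) - 1/sqrt(1/u-1)`. -/
theorem geometric_mean_two_integral_representation (x y t : ℝ)
    (hy : 0 < y) (hxy : y < x) (ht : -y < t) :
    Real.sqrt ((x + t) * (y + t))
      = Real.sqrt (x * y) + t +
        ((x - y) / (2 * Real.pi)) *
          ∫ s in Set.Ioi (0 : ℝ),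
            ((∫ u in (0 : ℝ)..(1 / 2),
                (Real.sqrt (1 / u - 1) - 1 / Real.sqrt (1 / u - 1)) *
                  (1 - Real.exp (-(1 - 2 * u) * ((x - y) * s))) *
                  Real.exp (-u * ((x - y) * s))) / s) *
              Real.exp (-y * s) * (1 - Real.exp (-s * t)) := by
  have hd : 0 < x - y := sub_pos.2 hxy
  have hyt : 0 < y + t := by linarith
  have hpi := Real.pi_pos
  have hint (b s : ℝ) : IntervalIntegrable
      (fun v : ℝ => √(v * (1 - v)) * Real.exp (-(b + v * (x - y)) * s)) MeasureTheory.volume 0 1 :=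
    Continuous.intervalIntegrable (by fun_prop) _ _
  rw [MeasureTheory.setIntegral_congr_fun (g := fun s => 2 * (x - y) *
    ((∫ v in (0 : ℝ)..1, √(v * (1 - v)) * Real.exp (-(y + v * (x - y)) * s)) -
      ∫ v in (0 : ℝ)..1, √(v * (1 - v)) * Real.exp (-(y + t + v * (x - y)) * s)))
    measurableSet_Ioi]
  · rw [MeasureTheory.integral_const_mul, MeasureTheory.integral_sub
      (integrableOn_integral_sqrt_mul_one_sub_mul_exp hy hd)
      (integrableOn_integral_sqrt_mul_one_sub_mul_exp hyt hd),
      integral_integral_sqrt_mul_one_sub_mul_exp hy hd,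
      integral_integral_sqrt_mul_one_sub_mul_exp hyt hd,
      show y + (x - y) = x by ring, show y + t + (x - y) = x + t by ring,
      mul_comm y x, mul_comm (y + t)]
    field_simp
    ring
  · intro s hs
    have hs : 0 < s := hs
    beta_reduce
    rw [integral_sqrt_sub_inv_sqrt_mul_exp, ← intervalIntegral.integral_sub (hint _ _) (hint _ _),
      show 2 * ((x - y) * s) * (∫ v in (0 : ℝ)..1, √(v * (1 - v)) *
        Real.exp (-v * ((x - y) * s))) / s = 2 * (x - y) * ∫ v in (0 : ℝ)..1, √(v * (1 - v)) *
        Real.exp (-v * ((x - y) * s)) by field_simp,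
      mul_assoc, mul_assoc, ← intervalIntegral.integral_mul_const]
    congr 1
    refine intervalIntegral.integral_congr fun v _ => ?_
    rw [show -(y + v * (x - y)) * s = -v * ((x - y) * s) + -y * s by ring,
      show -(y + t + v * (x - y)) * s = -v * ((x - y) * s) + -y * s + -s * t by ring,
      Real.exp_add, Real.exp_add, Real.exp_add]
    ring
end
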